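/- There exists an absolute constant C > 0 such that for every interval I = [t₀, t₁] and every smooth function u : I×ℝ³ → ℝ which is Schwartz in the space variable at each time, the variable-endpoint Duhamel integral w(t,x) = ∫_{t₀}^{t} (1/(4π(t−τ))) ∫_{|x−x'| = t−τ} u(τ,x')⁵ dS(x') dτ satisfies ‖w‖_{L⁸_{t,x}(I×ℝ³)} ≤ C ( sup_{t∈I} ‖∇ₓu(t,·)‖_{L²(ℝ³)} )^{1/2} ‖u‖_{L⁸_{t,x}(I×ℝ³)}^{9/2}. -/

import Mathlib

open MeasureTheory Real Set Function
open scoped ENNReal NNReal FourierTransform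

noncomputable section

/-- Three-dimensional Euclidean space `ℝ³`. -/
abbrev E3 : Type := EuclideanSpace ℝ (Fin 3)

/-- The time derivative `∂ₜ u` of a function `u : ℝ × ℝ³ → ℝ` (curried). -/
def tderiv (u : ℝ → E3 → ℝ) (t : ℝ) (x : E3) : ℝ := deriv (fun s => u s x) t

/-- The second time derivative `∂ₜ² u`. -/
def tderiv2 (u : ℝ → E3 → ℝ) (t : ℝ) (x : E3) : ℝ := deriv (fun s => tderiv u s x) t

/-- The spatial Laplacian `Δ f = ∑ᵢ ∂ᵢ² f` of `f : ℝ³ → ℝ`. -/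
def lap (f : E3 → ℝ) (x : E3) : ℝ :=
  ∑ i : Fin 3, iteratedFDeriv ℝ 2 f x ![EuclideanSpace.single i 1, EuclideanSpace.single i 1]

/-- `f : ℝ³ → ℝ` is a Schwartz function: it is smooth and all of its derivatives decay
faster than any polynomial. -/
def IsSchwartz (f : E3 → ℝ) : Prop :=
  ContDiff ℝ (⊤ : ℕ∞) f ∧ ∀ k n : ℕ, ∃ C : ℝ, ∀ x, ‖x‖ ^ k * ‖iteratedFDeriv ℝ n f x‖ ≤ C

/-- `u` is a smooth solution of the defocusing quintic nonlinear wave equation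
`∂ₜ²u − Δu + u⁵ = 0` on the time interval `I`, Schwartz in the space variable at each time. -/
def IsNLWOn (u : ℝ → E3 → ℝ) (I : Set ℝ) : Prop :=
  ContDiffOn ℝ (⊤ : ℕ∞) (uncurry u) (I ×ˢ univ) ∧
  (∀ t ∈ I, IsSchwartz (u t) ∧ IsSchwartz (tderiv u t)) ∧
  (∀ t ∈ I, ∀ x, tderiv2 u t x - lap (u t) x + (u t x) ^ 5 = 0)

/-- `u` is a smooth global solution of the defocusing quintic nonlinear wave equation. -/
def IsNLW (u : ℝ → E3 → ℝ) : Prop := IsNLWOn u univ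

/-- The energy `E(u(t)) = ∫ (1/2)|∂ₜu|² + (1/2)|∇ₓu|² + (1/6)u⁶ dx`. -/
def energy (u : ℝ → E3 → ℝ) (t : ℝ) : ℝ :=
  ∫ x : E3, ((1/2) * (tderiv u t x) ^ 2 + (1/2) * ‖gradient (u t) x‖ ^ 2 + (1/6) * (u t x) ^ 6)

/-- The spatial `L^q` norm (`q` finite), valued in `ℝ≥0∞`. -/
def xNorm {F : Type*} [NormedAddCommGroup F] (q : ℝ) (f : E3 → F) : ℝ≥0∞ :=
  (∫⁻ x : E3, (‖f x‖₊ : ℝ≥0∞) ^ q) ^ (1/q)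

/-- The mixed norm `‖u‖_{L^p_t L^q_x (I × ℝ³)}` for finite `p, q`. -/
def mixNorm (p q : ℝ) (I : Set ℝ) (u : ℝ → E3 → ℝ) : ℝ≥0∞ :=
  (∫⁻ t in I, (xNorm q (u t)) ^ p) ^ (1/p)

/-- The mixed norm `‖u‖_{L^∞_t L^q_x (I × ℝ³)}` (essential supremum in time). -/
def supNorm (q : ℝ) (I : Set ℝ) (u : ℝ → E3 → ℝ) : ℝ≥0∞ :=
  essSup (fun t => xNorm q (u t)) (volume.restrict I)

/-- The homogeneous Sobolev norm `‖f‖_{Ḣ^s} = (∫ |ξ|^{2s} |𝓕f(ξ)|² dξ)^{1/2}`. -/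
def sobNorm (s : ℝ) (f : E3 → ℝ) : ℝ≥0∞ :=
  (∫⁻ ξ : E3, (‖ξ‖₊ : ℝ≥0∞) ^ (2*s) *
    (‖𝓕 (fun x => (f x : ℂ)) ξ‖₊ : ℝ≥0∞) ^ (2:ℝ)) ^ ((1:ℝ)/2)

/-- The a priori bounds with constant `A`:
`‖u(t)‖_{L²} ≤ A`, `‖∂ₜu(t)‖_{Ḣ⁻¹} ≤ A`, `‖u(t)‖_{Ḣ²} ≤ A`, `‖∂ₜu(t)‖_{Ḣ¹} ≤ A` for all `t`. -/
def APriori (u : ℝ → E3 → ℝ) (A : ℝ) : Prop :=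
  ∀ t : ℝ, xNorm 2 (u t) ≤ ENNReal.ofReal A ∧ sobNorm (-1) (tderiv u t) ≤ ENNReal.ofReal A ∧
    sobNorm 2 (u t) ≤ ENNReal.ofReal A ∧ sobNorm 1 (tderiv u t) ≤ ENNReal.ofReal A

/-- The integral of `f` over the sphere of radius `r` about `x`, with respect to
two-dimensional Hausdorff (surface) measure. -/
def sphInt (x : E3) (r : ℝ) (f : E3 → ℝ) : ℝ := ∫ y in Metric.sphere x r, f y ∂(μH[2])

/-- The free wave evolution `S(t)(g, h)` given by Kirchhoff's formula. -/
def freeWave (g h : E3 → ℝ) (t : ℝ) (x : E3) : ℝ :=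
  if t = 0 then g x
  else deriv (fun s => (1/(4*π*s)) * sphInt x s g) t + (1/(4*π*t)) * sphInt x t h

/-- The Duhamel integral `D_{[s₁,s₂]}u(t,x) = ∫_{s₁}^{s₂} S(t−τ)(0, u(τ)⁵) dτ`,
written via Kirchhoff's formula. -/
def duh (u : ℝ → E3 → ℝ) (s₁ s₂ : ℝ) (t : ℝ) (x : E3) : ℝ :=
  ∫ τ in s₁..s₂, (1/(4*π*(t - τ))) * sphInt x (t - τ) (fun y => (u τ y) ^ 5)

theorem lintegral_rpow_indicator_lt {p : ℝ} (hp : 0 < p) (a : ℝ≥0∞) :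
    ∫⁻ l in Ioi (0 : ℝ), {l : ℝ | ENNReal.ofReal l < a}.indicator
      (fun l => ENNReal.ofReal (l ^ (p - 1))) l = a ^ p / ENNReal.ofReal p := by
  have key : ∀ b : ℝ, 0 ≤ b → ∫⁻ l in Ioo (0 : ℝ) b, ENNReal.ofReal (l ^ (p - 1))
      = ENNReal.ofReal b ^ p / ENNReal.ofReal p := by
    intro b hb
    rw [Measure.restrict_congr_set Ioo_ae_eq_Ioc, ← ofReal_integral_eq_lintegral_ofReal, ← intervalIntegral.integral_of_le hb,
      integral_rpow (by left; linarith)]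
    · rw [sub_add_cancel, zero_rpow hp.ne', sub_zero, ENNReal.ofReal_div_of_pos hp,
        ENNReal.ofReal_rpow_of_nonneg hb hp.le]
    · rw [← IntegrableOn, ← intervalIntegrable_iff_integrableOn_Ioc_of_le hb]
      exact intervalIntegral.intervalIntegrable_rpow' (by linarith)
    · filter_upwards [ae_restrict_mem measurableSet_Ioc] with l hl
      exact rpow_nonneg hl.1.le _
  by_cases ha : a = ∞
  · subst ha
    simp only [ENNReal.ofReal_lt_top, ofPred_true, indicator_univ]
    rw [ENNReal.top_rpow_of_pos hp, ENNReal.top_div_of_ne_top ENNReal.ofReal_ne_top, eq_top_iff]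
    refine ENNReal.le_of_forall_nnreal_lt fun r _ => ?_
    obtain ⟨b, hb0, hb⟩ : ∃ b : ℝ, 0 ≤ b ∧ (r : ℝ≥0∞) ≤ ENNReal.ofReal b ^ p / ENNReal.ofReal p := by
      refine ⟨(r * p) ^ (1 / p), by positivity, ?_⟩
      rw [ENNReal.ofReal_rpow_of_nonneg (by positivity) hp.le, ← rpow_mul (by positivity),
        one_div_mul_cancel hp.ne', rpow_one, ← ENNReal.ofReal_div_of_pos hp,
        mul_div_cancel_right₀ _ hp.ne', ENNReal.ofReal_coe_nnreal]
    rw [← key b hb0] at hb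
    exact hb.trans (lintegral_mono_set fun x hx => hx.1)
  · lift a to ℝ≥0 using ha
    rw [setLIntegral_indicator (by measurability)]
    have : {l : ℝ | ENNReal.ofReal l < a} ∩ Ioi 0 = Ioo 0 (a : ℝ) := by
      ext l
      simp only [mem_inter_iff, mem_ofPred_eq, mem_Ioi, mem_Ioo]
      constructor
      · rintro ⟨h1, h2⟩
        rw [← ENNReal.ofReal_coe_nnreal, ENNReal.ofReal_lt_ofReal_iff_of_nonneg h2.le] at h1
        exact ⟨h2, h1⟩
      · rintro ⟨h1, h2⟩
        rw [← ENNReal.ofReal_coe_nnreal, ENNReal.ofReal_lt_ofReal_iff_of_nonneg h1.le]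
        exact ⟨h2, h1⟩
    rw [this]
    refine (key a a.2).trans ?_
    rw [ENNReal.ofReal_coe_nnreal]

/-- Layer-cake formula for `[0, ∞]`-valued functions. -/
theorem lintegral_rpow_eq_lintegral_meas_lt {α : Type*} [MeasurableSpace α] (μ : Measure α)
    [SFinite μ] {p : ℝ} (hp : 0 < p) {G : α → ℝ≥0∞} (hG : Measurable G) :
    ∫⁻ t, G t ^ p ∂μ =
      ENNReal.ofReal p * ∫⁻ l in Ioi (0 : ℝ), ENNReal.ofReal (l ^ (p - 1)) *
        μ {t | ENNReal.ofReal l < G t} := by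
  have hp' : ENNReal.ofReal p ≠ 0 := by simpa using hp
  have h1 : ∀ t, G t ^ p = ENNReal.ofReal p * ∫⁻ l in Ioi (0 : ℝ),
      {l : ℝ | ENNReal.ofReal l < G t}.indicator (fun l => ENNReal.ofReal (l ^ (p - 1))) l := by
    intro t
    rw [lintegral_rpow_indicator_lt hp, ENNReal.mul_div_cancel hp' ENNReal.ofReal_ne_top]
  have hset : MeasurableSet {q : α × ℝ | ENNReal.ofReal q.2 < G q.1} :=
    measurableSet_lt (by fun_prop) (by fun_prop)
  have hm : Measurable (fun q : α × ℝ =>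
      {l : ℝ | ENNReal.ofReal l < G q.1}.indicator (fun l => ENNReal.ofReal (l ^ (p - 1))) q.2) := by
    have : (fun q : α × ℝ =>
      {l : ℝ | ENNReal.ofReal l < G q.1}.indicator (fun l => ENNReal.ofReal (l ^ (p - 1))) q.2)
      = {q : α × ℝ | ENNReal.ofReal q.2 < G q.1}.indicator
        (fun q => ENNReal.ofReal (q.2 ^ (p - 1))) := by
      ext q; simp [indicator]
    rw [this]
    exact Measurable.indicator (by fun_prop) hset
  simp_rw [h1]
  rw [lintegral_const_mul' _ _ ENNReal.ofReal_ne_top, lintegral_lintegral_swap hm.aemeasurable]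
  congr 1
  refine lintegral_congr fun l => ?_
  have : ∀ t, {l : ℝ | ENNReal.ofReal l < G t}.indicator
      (fun l => ENNReal.ofReal (l ^ (p - 1))) l =
      {t | ENNReal.ofReal l < G t}.indicator (fun _ => ENNReal.ofReal (l ^ (p - 1))) t := by
    intro t; simp [indicator]
  simp_rw [this]
  rw [lintegral_indicator_const (measurableSet_lt measurable_const hG)]

/-- The one-sided Riesz kernel `s₊^{-9/16}` restricted to `s ∈ A`. -/
def rieszKernel (A : Set ℝ) : ℝ → ℝ≥0∞ := A.indicator fun s => ENNReal.ofReal (s ^ (-(9 / 16) : ℝ))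

theorem measurable_rieszKernel {A : Set ℝ} (hA : MeasurableSet A) :
    Measurable (rieszKernel A) :=
  Measurable.indicator (by fun_prop) hA

theorem lintegral_rieszKernel_Ioc {ρ : ℝ} (hρ : 0 ≤ ρ) :
    ∫⁻ s, rieszKernel (Ioc 0 ρ) s = ENNReal.ofReal (16 / 7 * ρ ^ (7 / 16 : ℝ)) := by
  rw [rieszKernel, lintegral_indicator measurableSet_Ioc, ← ofReal_integral_eq_lintegral_ofReal,
    ← intervalIntegral.integral_of_le hρ, integral_rpow (by left; norm_num)]
  · congr 1
    norm_num
    ring_nf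
  · rw [← IntegrableOn, ← intervalIntegrable_iff_integrableOn_Ioc_of_le hρ]
    exact intervalIntegral.intervalIntegrable_rpow' (by norm_num)
  · filter_upwards [ae_restrict_mem measurableSet_Ioc] with l hl
    exact rpow_nonneg hl.1.le _

theorem lintegral_rieszKernel_Ioi {ρ : ℝ} (hρ : 0 < ρ) :
    ∫⁻ s, rieszKernel (Ioi ρ) s ^ (16 / 7 : ℝ) = ENNReal.ofReal (7 / 2 * ρ ^ (-(2 / 7) : ℝ)) := by
  have : ∀ s, rieszKernel (Ioi ρ) s ^ (16 / 7 : ℝ) =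
      (Ioi ρ).indicator (fun s => ENNReal.ofReal (s ^ (-(9 / 7) : ℝ))) s := by
    intro s
    by_cases hs : s ∈ Ioi ρ
    · have h0 : 0 < s := hρ.trans hs
      rw [rieszKernel, indicator_of_mem hs, indicator_of_mem hs,
        ENNReal.ofReal_rpow_of_nonneg (by positivity) (by norm_num), ← rpow_mul h0.le]
      norm_num
    · rw [rieszKernel, indicator_of_notMem hs, indicator_of_notMem hs,
        ENNReal.zero_rpow_of_pos (by norm_num)]
  simp_rw [this]
  rw [lintegral_indicator measurableSet_Ioi, ← ofReal_integral_eq_lintegral_ofReal,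
    integral_Ioi_rpow_of_lt (by norm_num) hρ]
  · congr 1
    norm_num
    ring_nf
  · exact integrableOn_Ioi_rpow_of_lt (by norm_num) hρ
  · filter_upwards [ae_restrict_mem measurableSet_Ioi] with l hl
    exact rpow_nonneg (hρ.trans hl).le _

theorem measurable_rieszKernel_sub_mul {A : Set ℝ} (hA : MeasurableSet A) {h : ℝ → ℝ≥0∞}
    (hh : Measurable h) : Measurable fun q : ℝ × ℝ => rieszKernel A (q.1 - q.2) * h q.2 :=
  ((measurable_rieszKernel hA).comp (by fun_prop)).mul (hh.comp measurable_snd)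

theorem lintegral_rieszKernel_far_le {h : ℝ → ℝ≥0∞} (hh : Measurable h)
    (hN : ∫⁻ τ, h τ ^ (16 / 9 : ℝ) ≤ 1) {l : ℝ} (hl : 0 < l) (t : ℝ) :
    ∫⁻ τ, rieszKernel (Ioi ((21 / l) ^ 8)) (t - τ) * h τ ≤ ENNReal.ofReal (l / 3) := by
  have hρ : 0 < (21 / l) ^ 8 := by positivity
  have hpq : (16 / 7 : ℝ).HolderConjugate (16 / 9) := by
    rw [Real.holderConjugate_iff]; norm_num
  have hkm : Measurable fun τ => rieszKernel (Ioi ((21 / l) ^ 8)) (t - τ) :=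
    (measurable_rieszKernel measurableSet_Ioi).comp (by fun_prop)
  refine (ENNReal.lintegral_mul_le_Lp_mul_Lq volume hpq hkm.aemeasurable
    hh.aemeasurable).trans ?_
  have h1 : ∫⁻ τ, rieszKernel (Ioi ((21 / l) ^ 8)) (t - τ) ^ (16 / 7 : ℝ) =
      ENNReal.ofReal (7 / 2 * ((21 / l) ^ 8) ^ (-(2 / 7) : ℝ)) := by
    rw [← lintegral_rieszKernel_Ioi hρ]
    exact lintegral_sub_left_eq_self (fun s => rieszKernel (Ioi ((21 / l) ^ 8)) s ^ (16 / 7 : ℝ)) t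
  rw [h1]
  calc _ ≤ ENNReal.ofReal (7 / 2 * ((21 / l) ^ 8) ^ (-(2 / 7) : ℝ)) ^ (1 / (16 / 7) : ℝ) * 1 := by
        gcongr
        exact ENNReal.rpow_le_one hN (by norm_num)
    _ ≤ _ := by
        rw [mul_one, ENNReal.ofReal_rpow_of_nonneg (by positivity) (by norm_num)]
        apply ENNReal.ofReal_le_ofReal
        rw [mul_rpow (by norm_num) (by positivity), ← rpow_natCast, ← rpow_mul (by positivity),
          ← rpow_mul (by positivity)]
        have : (21 / l) ^ ((8 : ℕ) * (-(2 / 7) * (1 / (16 / 7))) : ℝ) = l / 21 := by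
          norm_num
          rw [rpow_neg_one]; simp
        rw [this]
        have h2 : (7 / 2 : ℝ) ^ (1 / (16 / 7) : ℝ) ≤ 7 := by
          calc (7 / 2 : ℝ) ^ (1 / (16 / 7) : ℝ) ≤ (7 / 2 : ℝ) ^ (1 : ℝ) :=
                rpow_le_rpow_of_exponent_le (by norm_num) (by norm_num)
            _ ≤ 7 := by norm_num
        nlinarith

/-- The truncation height used at level `l` in the proof of the fractional integration estimate. -/
def cutHeight (l : ℝ) : ℝ := 7 / 48 * (21 : ℝ) ^ (-(7 / 2) : ℝ) * l ^ (9 / 2 : ℝ)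

theorem cutHeight_pos {l : ℝ} (hl : 0 < l) : 0 < cutHeight l := by
  unfold cutHeight; positivity

theorem cutHeight_mul {l : ℝ} (hl : 0 < l) :
    cutHeight l * (16 / 7 * ((21 / l) ^ 8) ^ (7 / 16 : ℝ)) = l / 3 := by
  have h1 : ((21 / l) ^ 8) ^ (7 / 16 : ℝ) = 21 ^ (7 / 2 : ℝ) * l ^ (-(7 / 2) : ℝ) := by
    rw [← rpow_natCast, ← rpow_mul (by positivity), div_eq_mul_inv,
      mul_rpow (by norm_num) (by positivity), ← rpow_neg_one l, ← rpow_mul hl.le]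
    norm_num
  have h2 : l ^ (9 / 2 : ℝ) * l ^ (-(7 / 2) : ℝ) = l := by
    rw [← rpow_add hl]; norm_num
  have h3 : (21 : ℝ) ^ (-(7 / 2) : ℝ) * 21 ^ (7 / 2 : ℝ) = 1 := by
    rw [← rpow_add (by norm_num)]; norm_num
  rw [h1, cutHeight]
  calc _ = 1 / 3 * ((21 : ℝ) ^ (-(7 / 2) : ℝ) * 21 ^ (7 / 2 : ℝ)) *
        (l ^ (9 / 2 : ℝ) * l ^ (-(7 / 2) : ℝ)) := by ring
    _ = _ := by rw [h2, h3]; ring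

theorem meas_rieszPotential_gt_le {h : ℝ → ℝ≥0∞} (hh : Measurable h)
    (hN : ∫⁻ τ, h τ ^ (16 / 9 : ℝ) ≤ 1) {l : ℝ} (hl : 0 < l) :
    volume {t | ENNReal.ofReal l < ∫⁻ τ, rieszKernel (Ioi 0) (t - τ) * h τ} ≤
      (ENNReal.ofReal (cutHeight l))⁻¹ *
        ∫⁻ τ, {τ | ENNReal.ofReal (cutHeight l) < h τ}.indicator h τ := by
  set m := ENNReal.ofReal (cutHeight l) with hm
  set ρ : ℝ := (21 / l) ^ 8 with hρ'
  have hρ : 0 < ρ := by positivity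
  set k := rieszKernel (Ioc 0 ρ)
  have hkm : Measurable k := measurable_rieszKernel measurableSet_Ioc
  have hS : MeasurableSet {τ | m < h τ} := measurableSet_lt measurable_const hh
  set g : ℝ → ℝ≥0∞ := {τ | m < h τ}.indicator h
  have hg : Measurable g := hh.indicator hS
  have hmk : m * ∫⁻ s, k s = ENNReal.ofReal (l / 3) := by
    rw [lintegral_rieszKernel_Ioc hρ.le, hm, ← ENNReal.ofReal_mul (cutHeight_pos hl).le,
      cutHeight_mul hl]
  have hm0 : m ≠ 0 := by simpa [hm] using cutHeight_pos hl
  have hmt : m ≠ ∞ := ENNReal.ofReal_ne_top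
  have hsub : {t | ENNReal.ofReal l < ∫⁻ τ, rieszKernel (Ioi 0) (t - τ) * h τ} ⊆
      {t | ENNReal.ofReal (l / 3) ≤ ∫⁻ τ, k (t - τ) * g τ} := by
    intro t ht
    by_contra hcon
    simp only [mem_ofPred_eq, not_le] at hcon ht
    refine absurd ht (not_lt.2 ?_)
    calc ∫⁻ τ, rieszKernel (Ioi 0) (t - τ) * h τ
        ≤ ∫⁻ τ, ((k (t - τ) * m + k (t - τ) * g τ) + rieszKernel (Ioi ρ) (t - τ) * h τ) := by
          apply lintegral_mono
          intro τ
          have e1 : rieszKernel (Ioi 0) (t - τ) = k (t - τ) + rieszKernel (Ioi ρ) (t - τ) := by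
            simp only [k, rieszKernel]
            rw [← Ioc_union_Ioi_eq_Ioi hρ.le, indicator_union_of_disjoint]
            exact Set.disjoint_left.2 fun x hx hx' => not_lt.2 hx.2 hx'
          have e2 : h τ ≤ m + g τ := by
            by_cases hτ : m < h τ
            · simp [g, hτ]
            · simp [g, hτ]; exact not_lt.1 hτ
          dsimp only
          rw [e1, add_mul, ← mul_add]
          gcongr
      _ = (∫⁻ τ, k (t - τ)) * m + (∫⁻ τ, k (t - τ) * g τ) +
            ∫⁻ τ, rieszKernel (Ioi ρ) (t - τ) * h τ := by
          rw [lintegral_add_left, lintegral_add_left, lintegral_mul_const]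
          · exact hkm.comp (by fun_prop)
          · exact (hkm.comp (by fun_prop)).mul_const _
          · exact ((hkm.comp (by fun_prop)).mul_const _).add ((hkm.comp (by fun_prop)).mul hg)
      _ ≤ ENNReal.ofReal (l / 3) + ENNReal.ofReal (l / 3) + ENNReal.ofReal (l / 3) := by
          gcongr
          · rw [lintegral_sub_left_eq_self k t, mul_comm, hmk]
          · exact lintegral_rieszKernel_far_le hh hN hl t
      _ = ENNReal.ofReal l := by
          rw [← ENNReal.ofReal_add (by positivity) (by positivity),
            ← ENNReal.ofReal_add (by positivity) (by positivity)]
          ring_nf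
  have hl3 : ENNReal.ofReal (l / 3) ≠ 0 := by simpa using hl
  refine (measure_mono hsub).trans ?_
  have hjm : Measurable fun q : ℝ × ℝ => k (q.1 - q.2) * g q.2 :=
    measurable_rieszKernel_sub_mul measurableSet_Ioc hg
  refine (meas_ge_le_lintegral_div hjm.lintegral_prod_right'.aemeasurable hl3
    ENNReal.ofReal_ne_top).trans ?_
  have : ∫⁻ t, ∫⁻ τ, k (t - τ) * g τ = (∫⁻ s, k s) * ∫⁻ τ, g τ := by
    rw [lintegral_lintegral_swap hjm.aemeasurable, ← lintegral_const_mul _ hg]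
    refine lintegral_congr fun τ => ?_
    have hkτ : Measurable fun x => k (x - τ) := hkm.comp (by fun_prop)
    rw [lintegral_mul_const _ hkτ, lintegral_sub_right_eq_self k τ]
  rw [this, ← hmk]
  have hk0 : (∫⁻ s, k s) ≠ 0 := by
    intro h0; rw [h0, mul_zero] at hmk; exact hl3 hmk.symm
  have hkt : (∫⁻ s, k s) ≠ ∞ := by
    rw [lintegral_rieszKernel_Ioc hρ.le]; exact ENNReal.ofReal_ne_top
  rw [mul_comm m, ENNReal.mul_div_mul_left _ _ hk0 hkt, div_eq_mul_inv, mul_comm]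

theorem exists_rieszPotential_bound_of_le_one : ∃ C : ℝ≥0∞, C ≠ ∞ ∧ ∀ h : ℝ → ℝ≥0∞, Measurable h →
    ∫⁻ τ, h τ ^ (16 / 9 : ℝ) ≤ 1 →
    ∫⁻ t, (∫⁻ τ, rieszKernel (Ioi 0) (t - τ) * h τ) ^ (8 : ℝ) ≤ C := by
  set a : ℝ := 7 / 48 * (21 : ℝ) ^ (-(7 / 2) : ℝ) with ha
  have ha0 : 0 < a := by positivity
  set A := ENNReal.ofReal a
  have hA0 : A ≠ 0 := by simpa [A] using ha0
  refine ⟨ENNReal.ofReal 8 * A⁻¹ * (A⁻¹ ^ (7 / 9 : ℝ) / ENNReal.ofReal (7 / 2)), ?_, ?_⟩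
  · refine ENNReal.mul_ne_top (ENNReal.mul_ne_top ENNReal.ofReal_ne_top (by simpa using hA0))
      (ENNReal.div_ne_top (ENNReal.rpow_ne_top_of_nonneg (by norm_num) (by simpa using hA0))
      (by simp))
  intro h hh hN
  have hjm : Measurable fun q : ℝ × ℝ => rieszKernel (Ioi 0) (q.1 - q.2) * h q.2 :=
    measurable_rieszKernel_sub_mul measurableSet_Ioi hh
  rw [lintegral_rpow_eq_lintegral_meas_lt volume (by norm_num) hjm.lintegral_prod_right']
  rw [mul_assoc]
  gcongr
  have hcut : ∀ l : ℝ, cutHeight l = a * l ^ (9 / 2 : ℝ) := fun l => by rw [cutHeight]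
  have hS : MeasurableSet {q : ℝ × ℝ | ENNReal.ofReal (cutHeight q.1) < h q.2} := by
    simp_rw [hcut]
    exact measurableSet_lt (by fun_prop) (by fun_prop)
  have key : ∀ τ, ∫⁻ l in Ioi (0 : ℝ), ENNReal.ofReal (l ^ (7 / 2 - 1 : ℝ)) *
      {τ | ENNReal.ofReal (cutHeight l) < h τ}.indicator h τ ≤
      A⁻¹ ^ (7 / 9 : ℝ) / ENNReal.ofReal (7 / 2) * h τ ^ (16 / 9 : ℝ) := by
    intro τ
    have e : ∫⁻ l in Ioi (0 : ℝ), ENNReal.ofReal (l ^ (7 / 2 - 1 : ℝ)) *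
      {τ | ENNReal.ofReal (cutHeight l) < h τ}.indicator h τ =
      ∫⁻ l in Ioi (0 : ℝ), {l : ℝ | ENNReal.ofReal l < (A⁻¹ * h τ) ^ (2 / 9 : ℝ)}.indicator
      (fun l => ENNReal.ofReal (l ^ (7 / 2 - 1 : ℝ))) l * h τ := by
      refine setLIntegral_congr_fun measurableSet_Ioi fun l hl => ?_
      have hl0 : (0 : ℝ) < l := hl
      have : ENNReal.ofReal (cutHeight l) < h τ ↔
          ENNReal.ofReal l < (A⁻¹ * h τ) ^ (2 / 9 : ℝ) := by
        have h1 : ENNReal.ofReal l = (ENNReal.ofReal (l ^ (9 / 2 : ℝ))) ^ (2 / 9 : ℝ) := by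
          rw [ENNReal.ofReal_rpow_of_nonneg (by positivity) (by norm_num), ← rpow_mul hl0.le]
          norm_num
        rw [h1, ENNReal.rpow_lt_rpow_iff (by norm_num), hcut, ENNReal.ofReal_mul ha0.le,
          mul_comm A⁻¹, ← div_eq_mul_inv, ENNReal.lt_div_iff_mul_lt (Or.inl hA0)
          (Or.inl ENNReal.ofReal_ne_top), mul_comm]
      by_cases hc : ENNReal.ofReal (cutHeight l) < h τ
      · simp [indicator, hc, this.1 hc]
      · have hc' : ¬ ENNReal.ofReal l < (A⁻¹ * h τ) ^ (2 / 9 : ℝ) := fun h' => hc (this.2 h')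
        simp [indicator, hc, hc']
    rw [e, lintegral_mul_const]
    · rw [lintegral_rpow_indicator_lt (by norm_num), ← ENNReal.rpow_mul,
        ENNReal.mul_rpow_of_nonneg _ _ (by norm_num)]
      apply le_of_eq
      rw [show (16 / 9 : ℝ) = 2 / 9 * (7 / 2) + 1 by norm_num,
        ENNReal.rpow_add_of_nonneg _ _ (by norm_num) (by norm_num), ENNReal.rpow_one,
        show (7 / 9 : ℝ) = 2 / 9 * (7 / 2) by norm_num]
      simp only [div_eq_mul_inv]
      ring
    · exact Measurable.indicator (by fun_prop) (measurableSet_lt (by fun_prop) measurable_const)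
  calc ∫⁻ l in Ioi (0 : ℝ), ENNReal.ofReal (l ^ (8 - 1 : ℝ)) *
        volume {t | ENNReal.ofReal l < ∫⁻ τ, rieszKernel (Ioi 0) (t - τ) * h τ}
      ≤ ∫⁻ l in Ioi (0 : ℝ), A⁻¹ * ∫⁻ τ, ENNReal.ofReal (l ^ (7 / 2 - 1 : ℝ)) *
        {τ | ENNReal.ofReal (cutHeight l) < h τ}.indicator h τ := by
        refine setLIntegral_mono' measurableSet_Ioi fun l hl => ?_
        have hl0 : (0 : ℝ) < l := hl
        refine (mul_le_mul_right (meas_rieszPotential_gt_le hh hN hl0) _).trans ?_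
        rw [lintegral_const_mul' _ _ ENNReal.ofReal_ne_top, ← mul_assoc, ← mul_assoc]
        refine mul_le_mul_left ?_ _
        rw [← ENNReal.ofReal_inv_of_pos (cutHeight_pos hl0), ← ENNReal.ofReal_inv_of_pos ha0,
          ← ENNReal.ofReal_mul (by positivity), ← ENNReal.ofReal_mul (by positivity), hcut]
        apply ENNReal.ofReal_le_ofReal
        rw [mul_inv, ← rpow_neg hl0.le, mul_left_comm, ← rpow_add hl0]
        norm_num
    _ = A⁻¹ * ∫⁻ τ, ∫⁻ l in Ioi (0 : ℝ), ENNReal.ofReal (l ^ (7 / 2 - 1 : ℝ)) *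
        {τ | ENNReal.ofReal (cutHeight l) < h τ}.indicator h τ := by
        rw [lintegral_const_mul' _ _ (by simpa using hA0), lintegral_lintegral_swap]
        have : (uncurry fun l τ => ENNReal.ofReal (l ^ (7 / 2 - 1 : ℝ)) *
            {τ | ENNReal.ofReal (cutHeight l) < h τ}.indicator h τ) = fun q : ℝ × ℝ =>
            ENNReal.ofReal (q.1 ^ (7 / 2 - 1 : ℝ)) *
            {q : ℝ × ℝ | ENNReal.ofReal (cutHeight q.1) < h q.2}.indicator (fun q => h q.2) q := by
          ext q; simp [uncurry, indicator]
        rw [this]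
        exact (Measurable.mul (by fun_prop) (Measurable.indicator (by fun_prop) hS)).aemeasurable
    _ ≤ A⁻¹ * ∫⁻ τ, A⁻¹ ^ (7 / 9 : ℝ) / ENNReal.ofReal (7 / 2) * h τ ^ (16 / 9 : ℝ) := by
        gcongr with τ
        exact key τ
    _ ≤ A⁻¹ * (A⁻¹ ^ (7 / 9 : ℝ) / ENNReal.ofReal (7 / 2) * 1) := by
        rw [lintegral_const_mul _ (by fun_prop)]
        gcongr
    _ = _ := by rw [mul_one]

/-- One-dimensional Hardy–Littlewood–Sobolev inequality from `L^{16/9}` to `L^8`. -/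
theorem exists_rieszPotential_bound : ∃ C : ℝ≥0∞, C ≠ ∞ ∧ ∀ h : ℝ → ℝ≥0∞, Measurable h →
    ∫⁻ t, (∫⁻ τ, rieszKernel (Ioi 0) (t - τ) * h τ) ^ (8 : ℝ) ≤
      C * (∫⁻ τ, h τ ^ (16 / 9 : ℝ)) ^ (9 / 2 : ℝ) := by
  obtain ⟨C, hC, H⟩ := exists_rieszPotential_bound_of_le_one
  refine ⟨C + 1, by simp [hC], fun h hh => ?_⟩
  set N := ∫⁻ τ, h τ ^ (16 / 9 : ℝ) with hN
  by_cases h0 : N = 0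
  · have : h =ᵐ[volume] 0 := by
      rw [hN, lintegral_eq_zero_iff (by fun_prop)] at h0
      filter_upwards [h0] with τ hτ
      simpa [ENNReal.rpow_eq_zero_iff, show ¬ ((16 : ℝ) / 9 < 0) by norm_num] using hτ
    have h1 : ∀ t, ∫⁻ τ, rieszKernel (Ioi 0) (t - τ) * h τ = 0 := by
      intro t
      rw [← lintegral_zero (μ := (volume : Measure ℝ))]
      apply lintegral_congr_ae
      filter_upwards [this] with τ hτ
      simp [hτ]
    simp [h1]
  by_cases ht : N = ∞
  · rw [ht, ENNReal.top_rpow_of_pos (by norm_num), ENNReal.mul_top (by simp)]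
    exact le_top
  set c := N ^ (-(9 / 16) : ℝ) with hc
  have hc0 : c ≠ 0 := by simp [hc, ENNReal.rpow_eq_zero_iff, h0, ht]
  have hct : c ≠ ∞ := by simp [hc, ENNReal.rpow_eq_top_iff, h0, ht]
  have h1 := H (fun τ => c * h τ) (hh.const_mul _) (by
    simp_rw [ENNReal.mul_rpow_of_nonneg _ _ (show (0 : ℝ) ≤ 16 / 9 by norm_num)]
    rw [lintegral_const_mul _ (by fun_prop), ← hN, hc, ← ENNReal.rpow_mul]
    norm_num
    rw [ENNReal.rpow_neg_one, ENNReal.inv_mul_cancel h0 ht])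
  have h2 : ∀ t, ∫⁻ τ, rieszKernel (Ioi 0) (t - τ) * (c * h τ) =
      c * ∫⁻ τ, rieszKernel (Ioi 0) (t - τ) * h τ := by
    intro t
    rw [← lintegral_const_mul' _ _ hct]
    refine lintegral_congr fun τ => by ring
  simp_rw [h2, ENNReal.mul_rpow_of_nonneg _ _ (show (0 : ℝ) ≤ 8 by norm_num)] at h1
  rw [lintegral_const_mul' _ _ (ENNReal.rpow_ne_top_of_nonneg (by norm_num) hct), hc,
    ← ENNReal.rpow_mul] at h1
  norm_num at h1
  calc _ = N ^ (9 / 2 : ℝ) * (N ^ (-(9 / 2) : ℝ) *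
        ∫⁻ t, (∫⁻ τ, rieszKernel (Ioi 0) (t - τ) * h τ) ^ (8 : ℝ)) := by
        rw [← mul_assoc, ← ENNReal.rpow_add _ _ h0 ht]
        norm_num
    _ ≤ N ^ (9 / 2 : ℝ) * (C + 1) := by
        gcongr
        refine le_trans (le_of_eq ?_) (h1.trans le_self_add)
        norm_num
    _ = _ := mul_comm _ _

section

open scoped Pointwise

/-- The surface measure on the unit sphere of `ℝ³` obtained from polar coordinates. -/
abbrev sphereMeasure : Measure (Metric.sphere (0 : E3) 1) := (volume : Measure E3).toSphere

/-- The point of the plane `{x | x i = ε}` whose other coordinates are given by `p`. -/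
def cubeFace (i : Fin 3) (ε : ℝ) (p : Fin 2 → ℝ) : E3 := WithLp.toLp 2 (i.insertNth ε p)

theorem cubeFace_apply_same (i : Fin 3) (ε : ℝ) (p : Fin 2 → ℝ) : cubeFace i ε p i = ε := by
  simp [cubeFace]

theorem smul_cubeFace (i : Fin 3) (ε a : ℝ) (p : Fin 2 → ℝ) :
    a • cubeFace i ε p = cubeFace i (a * ε) (a • p) := by
  ext j
  refine Fin.succAboveCases i ?_ (fun k => ?_) j <;> simp [cubeFace]

theorem abs_le_norm_cubeFace (i : Fin 3) (ε : ℝ) (p : Fin 2 → ℝ) : |ε| ≤ ‖cubeFace i ε p‖ := by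
  have := EuclideanSpace.norm_eq (cubeFace i ε p)
  have h := PiLp.norm_apply_le (cubeFace i ε p) i
  rwa [cubeFace_apply_same] at h

theorem norm_cubeFace_sub_le (i : Fin 3) (ε : ℝ) (p q : Fin 2 → ℝ) :
    ‖cubeFace i ε p - cubeFace i ε q‖ ≤ 2 * ‖p - q‖ := by
  rw [EuclideanSpace.norm_eq]
  apply Real.sqrt_le_iff.2
  refine ⟨by positivity, ?_⟩
  rw [Fin.sum_univ_succAbove _ i]
  have h : ∀ k, |p k - q k| ≤ ‖p - q‖ := fun k => by
    simpa using norm_le_pi_norm (p - q) k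
  simp [cubeFace, Fin.sum_univ_two, sq_abs]
  have h0 := sq_le_sq' (by linarith [abs_nonneg (p 0 - q 0), h 0]) (h 0)
  have h1 := sq_le_sq' (by linarith [abs_nonneg (p 1 - q 1), h 1]) (h 1)
  rw [sq_abs] at h0 h1
  nlinarith [sq_nonneg ‖p - q‖]

theorem norm_inv_norm_smul_sub_le {x y : E3} (hx : 1 ≤ ‖x‖) (hy : 1 ≤ ‖y‖) :
    ‖‖x‖⁻¹ • x - ‖y‖⁻¹ • y‖ ≤ 2 * ‖x - y‖ := by
  have hx0 : 0 < ‖x‖ := by linarith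
  have hy0 : 0 < ‖y‖ := by linarith
  have e : ‖x‖⁻¹ • x - ‖y‖⁻¹ • y = ‖x‖⁻¹ • ((x - y) + ((‖y‖ - ‖x‖) * ‖y‖⁻¹) • y) := by
    rw [smul_add, smul_sub, smul_smul, sub_add, ← sub_smul]
    congr 2
    field_simp
    ring
  rw [e, norm_smul, norm_inv, norm_norm]
  have h1 : ‖((‖y‖ - ‖x‖) * ‖y‖⁻¹) • y‖ ≤ ‖x - y‖ := by
    rw [norm_smul, norm_mul, norm_inv, norm_norm, mul_assoc, inv_mul_cancel₀ hy0.ne', mul_one,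
      Real.norm_eq_abs, norm_sub_rev x y]
    exact abs_norm_sub_norm_le y x
  calc ‖x‖⁻¹ * ‖(x - y) + ((‖y‖ - ‖x‖) * ‖y‖⁻¹) • y‖
      ≤ 1 * (‖x - y‖ + ‖x - y‖) := by
        gcongr
        · exact inv_le_one_of_one_le₀ hx
        · exact (norm_add_le _ _).trans (by gcongr)
    _ = _ := by ring

theorem lipschitzWith_normalize_cubeFace (i : Fin 3) {ε : ℝ} (hε : |ε| = 1) :
    LipschitzWith 4 fun p => ‖cubeFace i ε p‖⁻¹ • cubeFace i ε p := by
  refine LipschitzWith.of_dist_le_mul fun p q => ?_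
  rw [dist_eq_norm, dist_eq_norm]
  have h := norm_inv_norm_smul_sub_le (hε ▸ abs_le_norm_cubeFace i ε p)
    (hε ▸ abs_le_norm_cubeFace i ε q)
  have h2 := norm_cubeFace_sub_le i ε p q
  push_cast
  linarith

theorem volume_eq_lintegral_cubeFace (i : Fin 3) {C : Set E3} (hC : MeasurableSet C) :
    volume C = ∫⁻ s, volume {q | cubeFace i s q ∈ C} := by
  have h1 : MeasurePreserving (WithLp.toLp 2 : (Fin 3 → ℝ) → E3) :=
    (EuclideanSpace.volume_preserving_symm_measurableEquiv_toLp (Fin 3)).symm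
  have h2 := (volume_preserving_piFinSuccAbove (fun _ : Fin 3 => ℝ) i).symm
  have h3 := h1.comp h2
  rw [← h3.measure_preimage hC.nullMeasurableSet, Measure.volume_eq_prod,
    Measure.prod_apply (h3.measurable hC)]
  rfl

theorem hausdorffMeasure_face_le (i : Fin 3) {ε : ℝ} (hε : |ε| = 1) :
    ∃ K : ℝ≥0∞, K ≠ ∞ ∧ ∀ E : Set (Metric.sphere (0 : E3) 1), MeasurableSet E →
      μH[2] (Subtype.val '' E ∩ {x | 1 / 2 ≤ ε * x i}) ≤ K * sphereMeasure E := by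
  set c : ℝ≥0∞ := ENNReal.ofReal (1 / 16) * volume {s : ℝ | 1 / 4 < ε * s ∧ ε * s < 1 / 2}
  have hεε : ε * ε = 1 := by rw [← abs_mul_abs_self, hε, one_mul]
  have hSo : IsOpen {s : ℝ | 1 / 4 < ε * s ∧ ε * s < 1 / 2} :=
    isOpen_Ioo.preimage (continuous_const.mul continuous_id : Continuous fun s => ε * s)
  have hc : c ≠ 0 := by
    refine mul_ne_zero (by simp) ?_
    refine (hSo.measure_pos volume ⟨ε * (3 / 8), ?_, ?_⟩).ne'
    · rw [← mul_assoc, hεε]; norm_num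
    · rw [← mul_assoc, hεε]; norm_num
  refine ⟨(4 : ℝ≥0) ^ (2 : ℝ) * c⁻¹, ENNReal.mul_ne_top
    (ENNReal.rpow_ne_top_of_nonneg (by norm_num) ENNReal.coe_ne_top) (by simpa using hc), ?_⟩
  intro E hE
  set E' : Set E3 := Subtype.val '' E with hE'
  have hE'm : MeasurableSet E' := (MeasurableEmbedding.subtype_coe
    Metric.isClosed_sphere.measurableSet).measurableSet_image.2 hE
  have hE'1 : ∀ x ∈ E', ‖x‖ = 1 := by
    rintro _ ⟨x, -, rfl⟩
    simp
  set φ := fun p => ‖cubeFace i ε p‖⁻¹ • cubeFace i ε p with hφ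
  set P : Set (Fin 2 → ℝ) := {p | ‖cubeFace i ε p‖ ≤ 2 ∧ φ p ∈ E'}
  have h1 : E' ∩ {x | 1 / 2 ≤ ε * x i} ⊆ φ '' P := by
    rintro x ⟨hx, hxi⟩
    have hxi' : 1 / 2 ≤ ε * x i := hxi
    have hpos : 0 < ε * x i := by linarith
    have hF : cubeFace i ε (fun k => (ε * x i)⁻¹ * x (i.succAbove k)) = (ε * x i)⁻¹ • x := by
      ext j
      refine Fin.succAboveCases i ?_ (fun k => ?_) j
      · have : x i ≠ 0 := fun h => by simp [h] at hpos
        have : ε ≠ 0 := fun h => by simp [h] at hpos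
        simp only [cubeFace, Fin.insertNth_apply_same, PiLp.smul_apply, smul_eq_mul]
        field_simp
        nlinarith
      · simp [cubeFace]
    have hn : ‖(ε * x i)⁻¹ • x‖ = (ε * x i)⁻¹ := by
      rw [norm_smul, hE'1 x hx, mul_one, Real.norm_of_nonneg (by positivity)]
    have hφx : φ (fun k => (ε * x i)⁻¹ * x (i.succAbove k)) = x := by
      simp only [hφ]
      rw [hF, hn, smul_smul, inv_inv, mul_inv_cancel₀ hpos.ne', one_smul]
    refine ⟨fun k => (ε * x i)⁻¹ * x (i.succAbove k), ⟨?_, ?_⟩, hφx⟩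
    · rw [hF, hn]
      exact inv_le_of_inv_le₀ (by norm_num) (by linarith)
    · rw [hφx]; exact hx
  have h2 : μH[2] (E' ∩ {x | 1 / 2 ≤ ε * x i}) ≤ (4 : ℝ≥0) ^ (2 : ℝ) * volume P := by
    refine (measure_mono h1).trans ?_
    refine ((lipschitzWith_normalize_cubeFace i hε).hausdorffMeasure_image_le
      (by norm_num) P).trans ?_
    have := hausdorffMeasure_pi_real (ι := Fin 2)
    simp only [Fintype.card_fin, Nat.cast_ofNat] at this
    rw [this]
  set C : Set E3 := {x | 0 < ‖x‖ ∧ ‖x‖ < 1 ∧ ‖x‖⁻¹ • x ∈ E'}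
  have hCm : MeasurableSet C := by
    refine (measurableSet_lt measurable_const measurable_norm).inter
      ((measurableSet_lt measurable_norm measurable_const).inter ?_)
    exact (measurable_norm.inv.smul measurable_id) hE'm
  have hCE : volume C ≤ sphereMeasure E := by
    rw [Measure.toSphere_apply' _ hE]
    have : C ⊆ Ioo (0 : ℝ) 1 • E' := by
      rintro x ⟨h0, h1, h2⟩
      exact ⟨‖x‖, ⟨h0, h1⟩, _, h2, by
        show ‖x‖ • ‖x‖⁻¹ • x = x
        rw [smul_smul, mul_inv_cancel₀ h0.ne', one_smul]⟩
    calc volume C ≤ 1 * volume (Ioo (0 : ℝ) 1 • E') := by rw [one_mul]; exact measure_mono this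
      _ ≤ _ := by
        gcongr
        simp
  have h3 : c * volume P ≤ volume C := by
    rw [volume_eq_lintegral_cubeFace i hCm]
    calc c * volume P = ∫⁻ s in {s : ℝ | 1 / 4 < ε * s ∧ ε * s < 1 / 2},
          ENNReal.ofReal (1 / 16) * volume P := by
          rw [setLIntegral_const]; ring
      _ ≤ ∫⁻ s in {s : ℝ | 1 / 4 < ε * s ∧ ε * s < 1 / 2}, volume {q | cubeFace i s q ∈ C} := by
          refine setLIntegral_mono' hSo.measurableSet fun s hs => ?_
          have hs0 : 0 < ε * s := by linarith [hs.1]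
          have hsub : (ε * s) • P ⊆ {q | cubeFace i s q ∈ C} := by
            rintro _ ⟨p, ⟨hp1, hp2⟩, rfl⟩
            have e : cubeFace i s ((ε * s) • p) = (ε * s) • cubeFace i ε p := by
              rw [smul_cubeFace]
              congr 1
              rw [mul_right_comm, hεε, one_mul]
            have hn : 1 ≤ ‖cubeFace i ε p‖ := hε ▸ abs_le_norm_cubeFace i ε p
            show cubeFace i s ((ε * s) • p) ∈ C
            have hn' : ‖(ε * s) • cubeFace i ε p‖ = (ε * s) * ‖cubeFace i ε p‖ := by
              rw [norm_smul, Real.norm_of_nonneg hs0.le]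
            rw [e]
            refine ⟨?_, ?_, ?_⟩
            · rw [hn']; positivity
            · rw [hn']
              have := hs.2
              nlinarith
            · rw [hn', smul_smul, mul_inv_rev, mul_assoc, inv_mul_cancel₀ hs0.ne', mul_one]
              exact hp2
          refine le_trans ?_ (measure_mono hsub)
          rw [Measure.addHaar_smul]
          gcongr
          simp only [Module.finrank_fin_fun]
          rw [abs_of_nonneg (by positivity)]
          have := hs.1
          nlinarith
      _ ≤ _ := setLIntegral_le_lintegral _ _
  calc μH[2] (E' ∩ {x | 1 / 2 ≤ ε * x i}) ≤ (4 : ℝ≥0) ^ (2 : ℝ) * volume P := h2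
    _ ≤ (4 : ℝ≥0) ^ (2 : ℝ) * (c⁻¹ * sphereMeasure E) := by
        gcongr
        rw [mul_comm, ← div_eq_mul_inv, ENNReal.le_div_iff_mul_le (Or.inl hc)]
        · rw [mul_comm]; exact h3.trans hCE
        · left
          refine ENNReal.mul_ne_top ENNReal.ofReal_ne_top ?_
          refine ((measure_mono (t := Metric.closedBall (0 : ℝ) 1) ?_).trans_lt
            measure_closedBall_lt_top).ne
          rintro s ⟨h1, h2⟩
          rw [mem_closedBall_zero_iff, Real.norm_eq_abs, ← one_mul |s|, ← hε, ← abs_mul,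
            abs_of_pos (by linarith)]
          linarith
    _ = _ := by rw [mul_assoc]

theorem exists_hausdorffMeasure_le_sphereMeasure :
    ∃ K : ℝ≥0∞, K ≠ ∞ ∧ ∀ E : Set (Metric.sphere (0 : E3) 1), MeasurableSet E →
      μH[2] (Subtype.val '' E) ≤ K * sphereMeasure E := by
  choose K hK H using fun (i : Fin 3) (b : Bool) =>
    hausdorffMeasure_face_le i (ε := if b then 1 else -1) (by cases b <;> simp)
  refine ⟨∑ i, ∑ b, K i b, by simp [hK], fun E hE => ?_⟩
  have hsub : Subtype.val '' E ⊆ ⋃ i : Fin 3, ⋃ b : Bool,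
      (Subtype.val '' E ∩ {x : E3 | 1 / 2 ≤ (if b then 1 else -1) * x i}) := by
    intro x hx
    have hn : ‖x‖ = 1 := by
      obtain ⟨y, -, rfl⟩ := hx
      simp
    simp only [mem_iUnion]
    by_contra hcon
    push Not at hcon
    have h : ∀ i, |x i| < 1 / 2 := by
      intro i
      have h1 := fun h => hcon i true ⟨hx, h⟩
      have h2 := fun h => hcon i false ⟨hx, h⟩
      simp only [mem_ofPred_eq, if_true, Bool.false_eq_true, if_false] at h1 h2
      rw [abs_lt]
      constructor <;> by_contra hh
      · exact h2 (by linarith)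
      · exact h1 (by linarith)
    have h3 : ∑ i, x i ^ 2 = 1 := by
      rw [← EuclideanSpace.real_norm_sq_eq, hn, one_pow]
    rw [Fin.sum_univ_three] at h3
    have h4 : ∀ i, x i ^ 2 < 1 / 4 := fun i => by
      rw [← sq_abs]
      nlinarith [abs_nonneg (x i), h i]
    linarith [h4 0, h4 1, h4 2]
  calc μH[2] (Subtype.val '' E) ≤ ∑ i, ∑ b, K i b * sphereMeasure E := by
        refine (measure_mono hsub).trans ((measure_iUnion_fintype_le _ _).trans ?_)
        gcongr with i
        refine (measure_iUnion_fintype_le _ _).trans ?_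
        gcongr with b
        exact H i b E hE
    _ = _ := by simp_rw [Finset.sum_mul]

theorem exists_lintegral_sphere_hausdorff_le :
    ∃ K : ℝ≥0∞, K ≠ ∞ ∧ ∀ (x : E3) (r : ℝ), 0 < r → ∀ f : E3 → ℝ≥0∞, Measurable f →
      ∫⁻ y in Metric.sphere x r, f y ∂μH[2] ≤
        K * ENNReal.ofReal (r ^ 2) * ∫⁻ ω, f (x + r • (ω : E3)) ∂sphereMeasure := by
  obtain ⟨K, hK, H⟩ := exists_hausdorffMeasure_le_sphereMeasure
  refine ⟨K, hK, fun x r hr f hf => ?_⟩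
  have hΦ : Measurable fun ω : Metric.sphere (0 : E3) 1 => x + r • (ω : E3) := by fun_prop
  have hle : (μH[2] : Measure E3).restrict (Metric.sphere x r) ≤
      (K * ENNReal.ofReal (r ^ 2)) • sphereMeasure.map fun ω : Metric.sphere (0 : E3) 1 => x + r • (ω : E3) := by
    refine Measure.le_iff.2 fun B hB => ?_
    rw [Measure.restrict_apply hB, Measure.smul_apply, Measure.map_apply hΦ hB, smul_eq_mul]
    set E := (fun ω : Metric.sphere (0 : E3) 1 => x + r • (ω : E3)) ⁻¹' B
    have hsub : B ∩ Metric.sphere x r ⊆ (fun y : E3 => x + r • y) '' (Subtype.val '' E) := by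
      rintro y ⟨hyB, hy⟩
      have hy' : ‖y - x‖ = r := by simpa [dist_eq_norm] using hy
      have e : x + r • (r⁻¹ • (y - x)) = y := by
        rw [smul_smul, mul_inv_cancel₀ hr.ne', one_smul]; abel
      refine ⟨r⁻¹ • (y - x), ⟨⟨r⁻¹ • (y - x), ?_⟩, ?_, rfl⟩, e⟩
      · rw [mem_sphere_zero_iff_norm, norm_smul, hy', norm_inv, Real.norm_of_nonneg hr.le,
          inv_mul_cancel₀ hr.ne']
      · show x + r • (r⁻¹ • (y - x)) ∈ B
        rwa [e]
    have hL : LipschitzWith r.toNNReal fun y : E3 => x + r • y := by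
      refine LipschitzWith.of_dist_le_mul fun y z => ?_
      rw [dist_eq_norm, dist_eq_norm, add_sub_add_left_eq_sub, ← smul_sub, norm_smul,
        Real.norm_of_nonneg hr.le, Real.coe_toNNReal r hr.le]
    refine (measure_mono hsub).trans ((hL.hausdorffMeasure_image_le (by norm_num) _).trans ?_)
    have e : (r.toNNReal : ℝ≥0∞) ^ (2 : ℝ) = ENNReal.ofReal (r ^ 2) := by
      rw [ENNReal.ofReal_pow hr.le, ENNReal.ofReal]
      exact ENNReal.rpow_natCast _ 2
    rw [e, mul_comm K, mul_assoc]
    gcongr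
    exact H E (hΦ hB)
  calc _ ≤ ∫⁻ y, f y ∂((K * ENNReal.ofReal (r ^ 2)) • sphereMeasure.map fun ω : Metric.sphere (0 : E3) 1 => x + r • (ω : E3)) :=
        lintegral_mono' hle le_rfl
    _ = _ := by rw [lintegral_smul_measure, lintegral_map hf hΦ, smul_eq_mul]

end

/-- Integration in polar coordinates in `ℝ³`. -/
theorem lintegral_eq_lintegral_sphereMeasure {f : E3 → ℝ≥0∞} (hf : Measurable f) :
    ∫⁻ x, f x = ∫⁻ r in Ioi (0 : ℝ), ENNReal.ofReal (r ^ 2) *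
      ∫⁻ ω, f (r • (ω : E3)) ∂sphereMeasure := by
  have h1 := (volume : Measure E3).measurePreserving_homeomorphUnitSphereProd
  have h2 : ∀ q : ({0}ᶜ : Set E3),
      f ((homeomorphUnitSphereProd E3 q).2.1 • ((homeomorphUnitSphereProd E3 q).1 : E3)) = f q := by
    intro q
    rw [← homeomorphUnitSphereProd_symm_apply_coe, Homeomorph.symm_apply_apply]
  have hm : Measurable fun q : Metric.sphere (0 : E3) 1 × Ioi (0 : ℝ) => f (q.2.1 • (q.1 : E3)) :=
    hf.comp (by fun_prop)
  calc ∫⁻ x, f x = ∫⁻ x in ({0}ᶜ : Set E3), f x := by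
        rw [restrict_compl_singleton]
    _ = ∫⁻ q : ({0}ᶜ : Set E3), f q ∂(Measure.comap (↑) (volume : Measure E3)) := by
        rw [lintegral_subtype_comap (measurableSet_singleton _).compl]
    _ = ∫⁻ q, f (q.2.1 • (q.1 : E3)) ∂(sphereMeasure.prod
          (Measure.volumeIoiPow (Module.finrank ℝ E3 - 1))) := by
        rw [← h1.lintegral_comp hm]
        exact lintegral_congr fun q => (h2 q).symm
    _ = ∫⁻ r : Ioi (0 : ℝ), ∫⁻ ω, f (r.1 • (ω : E3)) ∂sphereMeasure
          ∂(Measure.volumeIoiPow (Module.finrank ℝ E3 - 1)) := lintegral_prod_symm' _ hm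
    _ = ∫⁻ r : Ioi (0 : ℝ), ENNReal.ofReal (r.1 ^ 2) *
          ∫⁻ ω, f (r.1 • (ω : E3)) ∂sphereMeasure ∂(Measure.comap Subtype.val volume) := by
        rw [Measure.volumeIoiPow, lintegral_withDensity_eq_lintegral_mul _ (by fun_prop)]
        · simp
        · exact hm.lintegral_prod_left'
    _ = _ := lintegral_subtype_comap measurableSet_Ioi fun r : ℝ => ENNReal.ofReal (r ^ 2) *
          ∫⁻ ω, f (r • (ω : E3)) ∂sphereMeasure

/-- The (unnormalised) spherical mean of `f` over the sphere of radius `r` about `x`. -/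
def sphMean (f : E3 → ℝ≥0∞) (r : ℝ) (x : E3) : ℝ≥0∞ := ∫⁻ ω, f (x + r • (ω : E3)) ∂sphereMeasure

theorem enorm_le_lintegral_enorm_deriv {g : ℝ → ℝ} (hg : ContDiff ℝ 1 g)
    (h0 : Filter.Tendsto g Filter.atTop (nhds 0)) (r : ℝ) :
    ‖g r‖ₑ ≤ ∫⁻ s in Ioi r, ‖deriv g s‖ₑ := by
  have h1 : Filter.Tendsto (fun R => ‖g R - g r‖ₑ) Filter.atTop (nhds ‖0 - g r‖ₑ) :=
    (h0.sub_const _).enorm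
  rw [zero_sub, enorm_neg] at h1
  refine le_of_tendsto h1 ?_
  filter_upwards [Filter.eventually_ge_atTop r] with R hR
  refine (enorm_sub_le_lintegral_deriv_of_contDiffOn_Icc hg.contDiffOn hR).trans ?_
  rw [Measure.restrict_congr_set (Ioc_ae_eq_Icc).symm]
  exact lintegral_mono_set fun s hs => hs.1

theorem sphMean_pow_five_le_lintegral {f : E3 → ℝ} (hf : ContDiff ℝ 1 f)
    (h0 : Filter.Tendsto f (Filter.cocompact E3) (nhds 0)) {r : ℝ} (hr : 0 < r) (x : E3) :
    ENNReal.ofReal (r ^ 2) * sphMean (fun y => ‖f y‖ₑ ^ 5) r x ≤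
      5 * ∫⁻ y, ‖f y‖ₑ ^ 4 * ‖fderiv ℝ f y‖ₑ := by
  set G : E3 → ℝ≥0∞ := fun y => ‖f y‖ₑ ^ 4 * ‖fderiv ℝ f y‖ₑ
  have hG : Measurable G :=
    (hf.continuous.enorm.measurable.pow_const 4).mul (hf.continuous_fderiv (by simp)).enorm.measurable
  have key : ∀ ω : Metric.sphere (0 : E3) 1, ENNReal.ofReal (r ^ 2) * ‖f (x + r • (ω : E3))‖ₑ ^ 5 ≤
      ∫⁻ s in Ioi (0 : ℝ), 5 * (ENNReal.ofReal (s ^ 2) * G (x + s • (ω : E3))) := by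
    intro ω
    have hω : ‖(ω : E3)‖ = 1 := by simp
    have hd : ∀ s : ℝ, HasDerivAt (fun s : ℝ => f (x + s • (ω : E3)) ^ 5)
        (5 * f (x + s • (ω : E3)) ^ 4 * fderiv ℝ f (x + s • (ω : E3)) ω) s := by
      intro s
      have h1 : HasDerivAt (fun s : ℝ => x + s • (ω : E3)) (ω : E3) s := by
        simpa using ((hasDerivAt_id s).smul_const (ω : E3)).const_add x
      have h2 : HasDerivAt (fun s : ℝ => f (x + s • (ω : E3)))
          (fderiv ℝ f (x + s • (ω : E3)) ω) s :=
        (hf.differentiable (by simp) (x + s • (ω : E3))).hasFDerivAt.comp_hasDerivAt s h1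
      simpa using h2.fun_pow 5
    have hc : ContDiff ℝ 1 fun s : ℝ => f (x + s • (ω : E3)) ^ 5 := by fun_prop
    have ht : Filter.Tendsto (fun s : ℝ => f (x + s • (ω : E3)) ^ 5) Filter.atTop (nhds 0) := by
      have : Filter.Tendsto (fun s : ℝ => x + s • (ω : E3)) Filter.atTop (Filter.cocompact E3) := by
        rw [← Metric.cobounded_eq_cocompact, ← tendsto_norm_atTop_iff_cobounded]
        refine Filter.tendsto_atTop_mono (f := fun s : ℝ => s - ‖x‖) (fun s => ?_)
          (Filter.tendsto_atTop_add_const_right _ _ Filter.tendsto_id)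
        have h1 := norm_sub_le (x + s • (ω : E3)) x
        rw [add_sub_cancel_left, norm_smul, hω, mul_one, Real.norm_eq_abs] at h1
        linarith [le_abs_self s]
      simpa using (h0.comp this).pow 5
    have h3 := enorm_le_lintegral_enorm_deriv hc ht r
    rw [enorm_pow] at h3
    calc ENNReal.ofReal (r ^ 2) * ‖f (x + r • (ω : E3))‖ₑ ^ 5
        ≤ ENNReal.ofReal (r ^ 2) * ∫⁻ s in Ioi r, ‖deriv (fun s : ℝ => f (x + s • (ω : E3)) ^ 5) s‖ₑ := by
          gcongr
      _ = ∫⁻ s in Ioi r, ENNReal.ofReal (r ^ 2) *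
            ‖deriv (fun s : ℝ => f (x + s • (ω : E3)) ^ 5) s‖ₑ := by
          rw [lintegral_const_mul' _ _ ENNReal.ofReal_ne_top]
      _ ≤ ∫⁻ s in Ioi r, 5 * (ENNReal.ofReal (s ^ 2) * G (x + s • (ω : E3))) := by
          refine setLIntegral_mono' measurableSet_Ioi fun s hs => ?_
          have hs' : r < s := hs
          rw [(hd s).deriv, enorm_mul, enorm_mul, enorm_pow, mul_left_comm]
          have e5 : ‖(5 : ℝ)‖ₑ = 5 := by
            rw [Real.enorm_of_nonneg (by norm_num)]; simp
          have hω' : ‖(ω : E3)‖ₑ = 1 := by rw [← ofReal_norm, hω]; simp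
          have : ‖fderiv ℝ f (x + s • (ω : E3)) ω‖ₑ ≤ ‖fderiv ℝ f (x + s • (ω : E3))‖ₑ := by
            simpa [hω'] using (fderiv ℝ f (x + s • (ω : E3))).le_opENorm (ω : E3)
          calc ‖(5 : ℝ)‖ₑ * ‖f (x + s • (ω : E3))‖ₑ ^ 4 *
                (ENNReal.ofReal (r ^ 2) * ‖fderiv ℝ f (x + s • (ω : E3)) ω‖ₑ)
              ≤ 5 * ‖f (x + s • (ω : E3))‖ₑ ^ 4 *
                (ENNReal.ofReal (s ^ 2) * ‖fderiv ℝ f (x + s • (ω : E3))‖ₑ) := by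
                rw [e5]
                gcongr
            _ = _ := by simp only [G]; ring
      _ ≤ _ := lintegral_mono_set (Ioi_subset_Ioi hr.le)
  have hm : Measurable fun q : Metric.sphere (0 : E3) 1 × ℝ => G (x + q.2 • (q.1 : E3)) :=
    hG.comp (by fun_prop)
  calc ENNReal.ofReal (r ^ 2) * sphMean (fun y => ‖f y‖ₑ ^ 5) r x
      = ∫⁻ ω : Metric.sphere (0 : E3) 1, ENNReal.ofReal (r ^ 2) * ‖f (x + r • (ω : E3))‖ₑ ^ 5
          ∂sphereMeasure := by
        rw [sphMean, lintegral_const_mul' _ _ ENNReal.ofReal_ne_top]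
    _ ≤ ∫⁻ ω : Metric.sphere (0 : E3) 1, (∫⁻ s in Ioi (0 : ℝ),
          5 * (ENNReal.ofReal (s ^ 2) * G (x + s • (ω : E3)))) ∂sphereMeasure := lintegral_mono key
    _ = ∫⁻ s in Ioi (0 : ℝ), ∫⁻ ω : Metric.sphere (0 : E3) 1,
          5 * (ENNReal.ofReal (s ^ 2) * G (x + s • (ω : E3))) ∂sphereMeasure := by
        rw [lintegral_lintegral_swap]
        have : Measurable fun q : Metric.sphere (0 : E3) 1 × ℝ => ENNReal.ofReal (q.2 ^ 2) := by
          fun_prop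
        exact ((this.mul hm).const_mul _).aemeasurable
    _ = 5 * ∫⁻ s in Ioi (0 : ℝ), ENNReal.ofReal (s ^ 2) * ∫⁻ ω : Metric.sphere (0 : E3) 1,
          G (x + s • (ω : E3)) ∂sphereMeasure := by
        rw [← lintegral_const_mul' _ _ (by simp)]
        refine lintegral_congr fun s => ?_
        rw [lintegral_const_mul' _ _ (by simp), lintegral_const_mul' _ _ ENNReal.ofReal_ne_top]
    _ = 5 * ∫⁻ y, G (x + y) := by
        have : Measurable fun y => G (x + y) := hG.comp (measurable_const_add x)
        rw [lintegral_eq_lintegral_sphereMeasure this]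
    _ = _ := by rw [lintegral_add_left_eq_self]

theorem sphMean_pow_five_le {f : E3 → ℝ} (hf : ContDiff ℝ 1 f)
    (h0 : Filter.Tendsto f (Filter.cocompact E3) (nhds 0)) {r : ℝ} (hr : 0 < r) (x : E3) :
    ENNReal.ofReal (r ^ 2) * sphMean (fun y => ‖f y‖ₑ ^ 5) r x ≤
      5 * ((∫⁻ y, ‖f y‖ₑ ^ (8 : ℝ)) ^ (1 / 2 : ℝ) *
        (∫⁻ y, ‖gradient f y‖ₑ ^ (2 : ℝ)) ^ (1 / 2 : ℝ)) := by
  refine (sphMean_pow_five_le_lintegral hf h0 hr x).trans ?_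
  gcongr
  have hpq : (2 : ℝ).HolderConjugate 2 := by rw [Real.holderConjugate_iff]; norm_num
  have h := ENNReal.lintegral_mul_le_Lp_mul_Lq (volume : Measure E3) hpq
    (f := fun y => ‖f y‖ₑ ^ 4) (g := fun y => ‖fderiv ℝ f y‖ₑ)
    (hf.continuous.enorm.measurable.pow_const 4).aemeasurable
    (hf.continuous_fderiv (by simp)).enorm.measurable.aemeasurable
  refine h.trans (le_of_eq ?_)
  congr 2
  · refine lintegral_congr fun y => ?_
    rw [← ENNReal.rpow_natCast, ← ENNReal.rpow_mul]
    norm_num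
  · refine lintegral_congr fun y => ?_
    congr 1
    rw [gradient, ← ofReal_norm, ← ofReal_norm, LinearIsometryEquiv.norm_map]

/-- The Fourier integral of an integrable square-integrable function represents its
`L²` Fourier transform. -/
theorem fourier_ae_eq_fourier_toLp {g : E3 → ℂ} (hg : Integrable g) (hg2 : MemLp g 2) :
    𝓕 g =ᵐ[volume] (𝓕 (hg2.toLp g) : Lp ℂ 2 (volume : Measure E3)) := by
  have hc : Continuous (𝓕 g) := VectorFourier.fourierIntegral_continuous
    Real.continuous_fourierChar (L := innerₗ E3) continuous_inner hg
  refine ae_eq_of_integral_contDiff_smul_eq hc.locallyIntegrable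
    ((Lp.memLp _).locallyIntegrable (by norm_num)) fun ψ hψ hψc => ?_
  have hg₁ : HasCompactSupport (Complex.ofRealCLM ∘ ψ) := hψc.comp_left rfl
  have hg₂ : ContDiff ℝ (⊤ : ℕ∞) (Complex.ofRealCLM ∘ ψ) := by fun_prop
  set Ψ := hg₁.toSchwartzMap hg₂ with hΨ
  have h1 : (Lp.toTemperedDistribution (𝓕 (hg2.toLp g))) Ψ =
      ∫ x, ψ x • (𝓕 (hg2.toLp g) : Lp ℂ 2 (volume : Measure E3)) x := by
    simp [Ψ]
  rw [← h1, ← Lp.fourier_toTemperedDistribution_eq, TemperedDistribution.fourier_apply,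
    Lp.toTemperedDistribution_apply]
  have h2 : ∫ x, (𝓕 Ψ) x • (hg2.toLp g) x = ∫ x, (𝓕 (Ψ : E3 → ℂ)) x • g x := by
    refine integral_congr_ae ?_
    filter_upwards [hg2.coeFn_toLp] with x hx
    rw [hx, SchwartzMap.fourier_coe]
  rw [h2]
  have h3 := VectorFourier.integral_bilin_fourierIntegral_eq_flip (ContinuousLinearMap.lsmul ℂ ℂ)
    (L := innerₗ E3) (μ := volume) (ν := volume) (f := (Ψ : E3 → ℂ)) (g := g)
    Real.continuous_fourierChar continuous_inner Ψ.integrable hg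
  simp only [flip_innerₗ, ContinuousLinearMap.lsmul_apply] at h3
  calc ∫ x, ψ x • (𝓕 g) x = ∫ x, (Ψ x) • (𝓕 g) x := by simp [Ψ]
    _ = _ := h3.symm

/-- Plancherel's theorem on `L¹ ∩ L²`. -/
theorem lintegral_enorm_fourier_sq {g : E3 → ℂ} (hg : Integrable g) (hg2 : MemLp g 2) :
    ∫⁻ ξ, ‖𝓕 g ξ‖ₑ ^ (2 : ℝ) = ∫⁻ x, ‖g x‖ₑ ^ (2 : ℝ) := by
  have h1 := fourier_ae_eq_fourier_toLp hg hg2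
  have h2 : eLpNorm (𝓕 g) 2 volume = eLpNorm g 2 volume := by
    rw [eLpNorm_congr_ae h1, ← Lp.enorm_def, ← eLpNorm_congr_ae hg2.coeFn_toLp, ← Lp.enorm_def,
      ← ofReal_norm, ← ofReal_norm, Lp.norm_fourier_eq]
  rw [eLpNorm_eq_lintegral_rpow_enorm_toReal (by norm_num) (by norm_num),
    eLpNorm_eq_lintegral_rpow_enorm_toReal (by norm_num) (by norm_num)] at h2
  have := ENNReal.rpow_left_injective (x := 1 / (2 : ℝ≥0∞).toReal) (by simp) h2
  simpa using this

theorem MeasureTheory.Integrable.memLp_two_of_bound {g : E3 → ℂ} (hg : Integrable g) {B : ℝ}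
    (hB : ∀ x, ‖g x‖ ≤ B) : MemLp g 2 := by
  refine (memLp_two_iff_integrable_sq_norm hg.1).2 ?_
  refine (hg.norm.const_mul B).mono' (hg.1.norm.pow 2) (Filter.Eventually.of_forall fun x => ?_)
  rw [Real.norm_eq_abs, abs_of_nonneg (by positivity), sq]
  exact mul_le_mul_of_nonneg_right (hB x) (norm_nonneg _)

/-- Convolution with a bounded integrable kernel is bounded on `L²` by the supremum of the
Fourier transform of the kernel. -/
theorem lintegral_enorm_convolution_sq_le {K f : E3 → ℝ} (hK : Integrable K) {B : ℝ}
    (hKB : ∀ x, |K x| ≤ B) (hf : Integrable f) {A : ℝ} (hfA : ∀ x, |f x| ≤ A) {D : ℝ≥0∞}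
    (hD : ∀ ξ ≠ 0, ‖𝓕 (fun x => (K x : ℂ)) ξ‖ₑ ≤ D) :
    ∫⁻ x, ‖∫ y, f y * K (x - y)‖ₑ ^ (2 : ℝ) ≤ D ^ (2 : ℝ) * ∫⁻ x, ‖f x‖ₑ ^ (2 : ℝ) := by
  set fc : E3 → ℂ := fun x => (f x : ℂ) with hfc
  set Kc : E3 → ℂ := fun x => (K x : ℂ) with hKc
  have hfi : Integrable fc := hf.ofReal
  have hKi : Integrable Kc := hK.ofReal
  set g : E3 → ℂ := MeasureTheory.convolution fc Kc (ContinuousLinearMap.mul ℂ ℂ) volume with hg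
  have hgi : Integrable g := hfi.integrable_convolution _ hKi
  have hgx : ∀ x, g x = ((∫ y, f y * K (x - y) : ℝ) : ℂ) := by
    intro x
    rw [hg, convolution, ← integral_complex_ofReal]
    simp [fc, Kc]
  have hgb : ∀ x, ‖g x‖ ≤ ∫ y, |f y| * B := by
    intro x
    rw [hgx, Complex.norm_real]
    refine norm_integral_le_of_norm_le (hf.abs.mul_const B) (Filter.Eventually.of_forall fun y => ?_)
    rw [norm_mul]
    exact mul_le_mul_of_nonneg_left (hKB _) (norm_nonneg _)
  have h1 := lintegral_enorm_fourier_sq hgi (hgi.memLp_two_of_bound hgb)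
  have h2 := lintegral_enorm_fourier_sq hfi
    (hfi.memLp_two_of_bound (B := A) fun x => by simpa [fc] using hfA x)
  calc ∫⁻ x, ‖∫ y, f y * K (x - y)‖ₑ ^ (2 : ℝ) = ∫⁻ x, ‖g x‖ₑ ^ (2 : ℝ) := by
        refine lintegral_congr fun x => ?_
        rw [hgx, ← ofReal_norm, ← ofReal_norm, Complex.norm_real]
    _ = ∫⁻ ξ, ‖𝓕 g ξ‖ₑ ^ (2 : ℝ) := h1.symm
    _ ≤ ∫⁻ ξ, D ^ (2 : ℝ) * ‖𝓕 fc ξ‖ₑ ^ (2 : ℝ) := by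
        refine lintegral_mono_ae ?_
        have : ∀ᵐ ξ : E3, ξ ≠ 0 := by simp [ae_iff]
        filter_upwards [this] with ξ hξ
        rw [hg, Real.fourier_mul_convolution_eq hfi hKi, enorm_mul,
          ENNReal.mul_rpow_of_nonneg _ _ (by norm_num), mul_comm]
        gcongr
        exact hD ξ hξ
    _ = D ^ (2 : ℝ) * ∫⁻ ξ, ‖𝓕 fc ξ‖ₑ ^ (2 : ℝ) := by
        rw [lintegral_const_mul]
        have : Continuous (𝓕 fc) := VectorFourier.fourierIntegral_continuous
          Real.continuous_fourierChar (L := innerₗ E3) continuous_inner hfi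
        exact (this.measurable.enorm).pow_const _
    _ = D ^ (2 : ℝ) * ∫⁻ x, ‖f x‖ₑ ^ (2 : ℝ) := by
        rw [h2]
        congr 1
        refine lintegral_congr fun x => ?_
        rw [← ofReal_norm, ← ofReal_norm, Complex.norm_real]

theorem integral_coord_ball {R : ℝ} (hR : 0 ≤ R) {φ : ℝ → ℂ} (hφ : Continuous φ) :
    ∫ x in Metric.ball (0 : E3) R, φ (x 0) = ∫ s in -R..R, ((π * (R ^ 2 - s ^ 2) : ℝ) : ℂ) * φ s := by
  have h1 : MeasurePreserving (WithLp.toLp 2 : (Fin 3 → ℝ) → E3) :=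
    (EuclideanSpace.volume_preserving_symm_measurableEquiv_toLp (Fin 3)).symm
  have h2 := (volume_preserving_piFinSuccAbove (fun _ : Fin 3 => ℝ) 0).symm
  have h3 := h1.comp h2
  have hm1 : MeasurableEmbedding (WithLp.toLp 2 : (Fin 3 → ℝ) → E3) :=
    (MeasurableEquiv.toLp 2 (Fin 3 → ℝ)).measurableEmbedding
  have hm := hm1.comp (MeasurableEquiv.piFinSuccAbove (fun _ : Fin 3 => ℝ) 0).symm.measurableEmbedding
  have hint : Integrable (fun x : E3 => (Metric.ball (0 : E3) R).indicator (fun x => φ (x 0)) x) := by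
    rw [integrable_indicator_iff measurableSet_ball]
    refine IntegrableOn.mono_set (t := Metric.closedBall 0 R) ?_ Metric.ball_subset_closedBall
    exact (by fun_prop : Continuous fun x : E3 => φ (x 0)).continuousOn.integrableOn_compact
      (isCompact_closedBall _ _)
  rw [← integral_indicator measurableSet_ball, ← h3.integral_comp hm, Measure.volume_eq_prod,
    integral_prod _ (by
      have := (h3.integrable_comp_emb hm).2 hint
      exact this)]
  have hdisc : ∀ s : ℝ, volume.real {p : Fin 2 → ℝ | s ^ 2 + (p 0 ^ 2 + p 1 ^ 2) < R ^ 2} =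
      if s ∈ Ioc (-R) R then π * (R ^ 2 - s ^ 2) else 0 := by
    intro s
    have e : {p : Fin 2 → ℝ | s ^ 2 + (p 0 ^ 2 + p 1 ^ 2) < R ^ 2} =
        (WithLp.toLp 2 : (Fin 2 → ℝ) → _) ⁻¹'
          (Metric.ball (0 : EuclideanSpace ℝ (Fin 2)) (√(R ^ 2 - s ^ 2))) := by
      ext p
      rw [mem_preimage, EuclideanSpace.ball_zero_eq _ (Real.sqrt_nonneg _)]
      simp only [Set.mem_ofPred_eq, Fin.sum_univ_two]
      by_cases h : 0 ≤ R ^ 2 - s ^ 2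
      · rw [Real.sq_sqrt h]
        constructor <;> intro h <;> linarith
      · rw [Real.sqrt_eq_zero_of_nonpos (by linarith)]
        constructor <;> intro h' <;> nlinarith [sq_nonneg (p 0), sq_nonneg (p 1)]
    have hpres : MeasurePreserving (WithLp.toLp 2 : (Fin 2 → ℝ) → EuclideanSpace ℝ (Fin 2)) :=
      (EuclideanSpace.volume_preserving_symm_measurableEquiv_toLp (Fin 2)).symm
    rw [e, Measure.real, hpres.measure_preimage measurableSet_ball.nullMeasurableSet,
      EuclideanSpace.volume_ball_fin_two, ENNReal.toReal_mul, ENNReal.toReal_pow,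
      ENNReal.toReal_ofReal (Real.sqrt_nonneg _)]
    split_ifs with h
    · rw [Real.sq_sqrt (by nlinarith [h.1, h.2]), mul_comm, ENNReal.toReal_ofReal Real.pi_pos.le]
    · rw [Real.sqrt_eq_zero_of_nonpos]
      · simp
      · by_contra! h'
        exact h ⟨by nlinarith, by nlinarith⟩
  rw [intervalIntegral.integral_of_le (by linarith), ← integral_indicator measurableSet_Ioc]
  refine integral_congr_ae (Filter.Eventually.of_forall fun s => ?_)
  have e : ∀ p : Fin 2 → ℝ, (Metric.ball (0 : E3) R).indicator (fun x => φ (x 0))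
      (WithLp.toLp 2 ((MeasurableEquiv.piFinSuccAbove (fun _ : Fin 3 => ℝ) 0).symm (s, p))) =
      {p : Fin 2 → ℝ | s ^ 2 + (p 0 ^ 2 + p 1 ^ 2) < R ^ 2}.indicator (fun _ => φ s) p := by
    intro p
    rw [EuclideanSpace.ball_zero_eq _ hR]
    simp only [Set.indicator, Set.mem_ofPred_eq, Fin.sum_univ_three]
    have e0 : ((MeasurableEquiv.piFinSuccAbove (fun _ : Fin 3 => ℝ) 0).symm (s, p)) 0 = s := rfl
    have e1 : ((MeasurableEquiv.piFinSuccAbove (fun _ : Fin 3 => ℝ) 0).symm (s, p)) 1 = p 0 := rfl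
    have e2 : ((MeasurableEquiv.piFinSuccAbove (fun _ : Fin 3 => ℝ) 0).symm (s, p)) 2 = p 1 := rfl
    rw [e0, e1, e2, add_assoc]
  simp only [comp_apply]
  rw [integral_congr_ae (Filter.Eventually.of_forall e), integral_indicator_const, hdisc]
  · simp only [Set.indicator]
    split_ifs
    · rfl
    · simp
  · exact measurableSet_lt (by fun_prop) (by fun_prop)

/-- The integral `∫_{-R}^{R} π (R² - s²) e^{ks} ds`, in closed form. -/
def ballHat (k : ℂ) (R : ℝ) : ℂ :=
  π * (Complex.exp (k * R) * (2 * R / k ^ 2 - 2 / k ^ 3) +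
    Complex.exp (-(k * R)) * (2 * R / k ^ 2 + 2 / k ^ 3))

theorem integral_disc_mul_exp {k : ℂ} (hk : k ≠ 0) (R : ℝ) :
    ∫ s in -R..R, ((π * (R ^ 2 - s ^ 2) : ℝ) : ℂ) * Complex.exp (k * s) = ballHat k R := by
  have hd : ∀ s ∈ uIcc (-R) R, HasDerivAt (fun s : ℝ => (π : ℂ) * (Complex.exp (k * s) *
      (((R : ℂ) ^ 2 - (s : ℂ) ^ 2) / k + 2 * s / k ^ 2 - 2 / k ^ 3)))
      (((π * (R ^ 2 - s ^ 2) : ℝ) : ℂ) * Complex.exp (k * s)) s := by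
    intro s _
    have h0 : HasDerivAt (fun s : ℝ => (s : ℂ)) 1 s := HasDerivAt.ofReal_comp (hasDerivAt_id s)
    have h1 := (h0.const_mul k).cexp
    have h2 := ((((h0.fun_pow 2).const_sub ((R : ℂ) ^ 2)).div_const k).add
      ((h0.const_mul 2).div_const (k ^ 2))).sub_const (2 / k ^ 3)
    refine ((h1.mul h2).const_mul (π : ℂ)).congr_deriv ?_
    push_cast
    simp only [Pi.add_apply]
    field_simp
    ring
  rw [intervalIntegral.integral_eq_sub_of_hasDerivAt hd]
  · rw [ballHat]
    push_cast
    rw [mul_neg]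
    ring
  · exact (by fun_prop : Continuous _).intervalIntegrable _ _

theorem fourier_indicator_ball {R : ℝ} (hR : 0 ≤ R) {ξ : E3} (hξ : ξ ≠ 0) :
    𝓕 (fun x : E3 => (((Metric.ball 0 R).indicator (fun _ => (1 : ℝ)) x : ℝ) : ℂ)) ξ =
      ballHat (-(2 * π * ‖ξ‖) * Complex.I) R := by
  set f : E3 → ℂ := fun x => (((Metric.ball 0 R).indicator (fun _ => (1 : ℝ)) x : ℝ) : ℂ) with hf
  set η : E3 := EuclideanSpace.single 0 ‖ξ‖ with hη
  have hn : ‖η‖ = ‖ξ‖ := by simp [η]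
  set A := (ℝ ∙ (η - ξ))ᗮ.reflection with hA
  have hAη : A η = ξ := Submodule.reflection_sub hn
  have hfA : f ∘ A = f := by
    funext x
    have : A x ∈ Metric.ball (0 : E3) R ↔ x ∈ Metric.ball (0 : E3) R := by
      simp
    by_cases hx : x ∈ Metric.ball (0 : E3) R
    · simp only [hf, comp_apply, Set.indicator_of_mem hx, Set.indicator_of_mem (this.2 hx)]
    · simp only [hf, comp_apply, Set.indicator_of_notMem hx,
        Set.indicator_of_notMem (this.not.2 hx)]
  have hk : (-(2 * π * ‖ξ‖) * Complex.I : ℂ) ≠ 0 := by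
    simp [hξ, Real.pi_ne_zero]
  rw [← integral_disc_mul_exp hk, ← integral_coord_ball hR (by fun_prop), ← hAη,
    ← Real.fourier_comp_linearIsometry A f η, hfA, Real.fourier_eq', hAη,
    ← integral_indicator measurableSet_ball]
  refine integral_congr_ae (Filter.Eventually.of_forall fun x => ?_)
  by_cases hx : x ∈ Metric.ball (0 : E3) R
  · simp only [hf, Set.indicator_of_mem hx, Complex.ofReal_one, smul_eq_mul, mul_one]
    congr 1
    simp [η, EuclideanSpace.inner_single_right]
    ring
  · simp [hf, Set.indicator_of_notMem hx]

theorem norm_ballHat_second_difference_le {k : ℝ} (hk : k ≠ 0) {a h M : ℝ} (ha : 0 ≤ a)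
    (hh : 0 ≤ h) (hM : a + 2 * h ≤ M) :
    ‖ballHat (k * Complex.I) (a + 2 * h) - 2 * ballHat (k * Complex.I) (a + h) +
      ballHat (k * Complex.I) a‖ ≤ 8 * π * M * h ^ 2 := by
  set κ : ℂ := k * Complex.I with hκ
  have hκ0 : κ ≠ 0 := by simp [κ, hk]
  set b1 : ℝ → ℂ := fun R => (π : ℂ) * (2 * R / κ * (Complex.exp (κ * R) - Complex.exp (-(κ * R))))
  set b2 : ℝ → ℂ := fun R => (π : ℂ) * (2 / κ * (Complex.exp (κ * R) - Complex.exp (-(κ * R))) +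
    2 * R * (Complex.exp (κ * R) + Complex.exp (-(κ * R))))
  have h0 : ∀ s : ℝ, HasDerivAt (fun s : ℝ => (s : ℂ)) 1 s := fun s =>
    HasDerivAt.ofReal_comp (hasDerivAt_id s)
  have hd1 : ∀ R, HasDerivAt (ballHat κ) (b1 R) R := by
    intro R
    have e1 := ((h0 R).const_mul κ).cexp
    have e2 := ((h0 R).const_mul κ).fun_neg.cexp
    have e3 := (((h0 R).const_mul 2).div_const (κ ^ 2)).sub_const (2 / κ ^ 3)
    have e4 := (((h0 R).const_mul 2).div_const (κ ^ 2)).add_const (2 / κ ^ 3)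
    refine (((e1.mul e3).add (e2.mul e4)).const_mul (π : ℂ)).congr_deriv ?_
    simp only [b1]
    field_simp
    ring
  have hd2 : ∀ R, HasDerivAt b1 (b2 R) R := by
    intro R
    have e1 := ((h0 R).const_mul κ).cexp
    have e2 := ((h0 R).const_mul κ).fun_neg.cexp
    have e3 := ((h0 R).const_mul 2).div_const κ
    refine ((e3.mul (e1.sub e2)).const_mul (π : ℂ)).congr_deriv ?_
    simp only [b2, Pi.sub_apply]
    field_simp
    ring
  have hn2 : ∀ R, |R| ≤ M → ‖b2 R‖ ≤ 8 * π * M := by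
    intro R hR
    have ee : ∀ θ : ℝ, ‖Complex.exp (κ * θ)‖ = 1 := by
      intro θ
      have : κ * θ = ((k * θ : ℝ) : ℂ) * Complex.I := by simp only [κ]; push_cast; ring
      rw [this, Complex.norm_exp_ofReal_mul_I]
    have ee' : ‖Complex.exp (-(κ * R))‖ = 1 := by
      have := ee (-R); push_cast at this; rwa [mul_neg] at this
    have es : ‖Complex.exp (κ * R) - Complex.exp (-(κ * R))‖ ≤ 2 * ‖κ‖ * |R| := by
      have h1 : Complex.exp (κ * R) - Complex.exp (-(κ * R)) =
          Complex.exp (-(κ * R)) * (Complex.exp (Complex.I * ((2 * (k * R) : ℝ) : ℂ)) - 1) := by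
        rw [mul_sub, ← Complex.exp_add, mul_one]
        congr 2
        simp only [κ]; push_cast; ring
      rw [h1, norm_mul, ee', one_mul]
      refine (Real.norm_exp_I_mul_ofReal_sub_one_le).trans (le_of_eq ?_)
      simp [κ, mul_assoc]
    have hκn : 0 < ‖κ‖ := norm_pos_iff.2 hκ0
    calc ‖b2 R‖ ≤ π * (2 / ‖κ‖ * (2 * ‖κ‖ * |R|) + 2 * |R| * (1 + 1)) := by
          simp only [b2]
          rw [norm_mul, Complex.norm_real, Real.norm_of_nonneg Real.pi_pos.le]
          gcongr
          refine (norm_add_le _ _).trans ?_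
          rw [norm_mul, norm_mul, norm_mul, norm_div]
          simp only [Complex.norm_ofNat, Complex.norm_real, Real.norm_eq_abs]
          gcongr
          refine (norm_add_le _ _).trans ?_
          rw [ee, ee']
      _ = 8 * π * |R| := by field_simp; ring
      _ ≤ _ := by gcongr
  have hd3 : ∀ s ∈ Icc (0 : ℝ) h, ‖b1 (a + h + s) - b1 (a + s)‖ ≤ 8 * π * M * h := by
    intro s hs
    have := Convex.norm_image_sub_le_of_norm_hasDerivWithin_le (f := b1) (f' := b2)
      (s := Icc (a + s) (a + h + s)) (C := 8 * π * M) (fun x _ => (hd2 x).hasDerivWithinAt)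
      (fun x hx => hn2 x (abs_le.2 ⟨by linarith [hs.1, hx.1], by linarith [hs.2, hx.2]⟩))
      (convex_Icc _ _) (left_mem_Icc.2 (by linarith)) (right_mem_Icc.2 (by linarith))
    refine this.trans (le_of_eq ?_)
    rw [Real.norm_of_nonneg (by linarith)]
    ring
  have := Convex.norm_image_sub_le_of_norm_hasDerivWithin_le
      (f := fun s => ballHat κ (a + h + s) - ballHat κ (a + s))
      (f' := fun s => b1 (a + h + s) - b1 (a + s))
      (s := Icc 0 h) (C := 8 * π * M * h)
      (fun x _ => (((hd1 _).comp_const_add (a + h) x).sub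
        ((hd1 _).comp_const_add a x)).hasDerivWithinAt)
      hd3 (convex_Icc _ _) (left_mem_Icc.2 hh) (right_mem_Icc.2 hh)
  rw [sub_zero, Real.norm_of_nonneg hh] at this
  calc _ = _ := by
        congr 1
        have : a + h + h = a + 2 * h := by ring
        simp only [add_zero, this]
        ring
    _ ≤ _ := this
    _ = _ := by ring

theorem measurable_integral_mul_sub {f K : E3 → ℝ} (hf : Measurable f) (hK : Measurable K) :
    Measurable fun x => ∫ y, f y * K (x - y) := by
  have h : Measurable (uncurry fun x y : E3 => f y * K (x - y)) := by
    have h1 : Measurable fun q : E3 × E3 => f q.2 := hf.comp measurable_snd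
    have h2 : Measurable fun q : E3 × E3 => K (q.1 - q.2) := hK.comp (by fun_prop)
    exact h1.mul h2
  exact (h.stronglyMeasurable.integral_prod_right).measurable

theorem lintegral_Ioc_rpow_neg_third {ρ : ℝ} (hρ : 0 ≤ ρ) :
    ∫⁻ s in Ioc 0 ρ, ENNReal.ofReal (s ^ (-(1 / 3) : ℝ)) =
      ENNReal.ofReal (3 / 2 * ρ ^ (2 / 3 : ℝ)) := by
  have hi : IntegrableOn (fun s : ℝ => s ^ (-(1 / 3) : ℝ)) (Ioc 0 ρ) :=
    (intervalIntegrable_iff_integrableOn_Ioc_of_le hρ).1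
      (intervalIntegral.intervalIntegrable_rpow' (by norm_num))
  rw [← ofReal_integral_eq_lintegral_ofReal hi]
  · rw [← intervalIntegral.integral_of_le hρ, integral_rpow (Or.inl (by norm_num)),
      Real.zero_rpow (by norm_num)]
    congr 1
    norm_num
    ring
  · refine (ae_restrict_iff' measurableSet_Ioc).2 (Filter.Eventually.of_forall fun s hs => ?_)
    exact Real.rpow_nonneg hs.1.le _

/-- If convolution with a bounded kernel `K` has `L²` norm at most `D`, then interpolating with
the bound from `L¹` to `L^∞` controls it from `L^{8/5}` to `L^{8/3}`. -/
theorem lintegral_enorm_convolution_rpow_le {K f : E3 → ℝ} (hKm : Measurable K)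
    (hK : Integrable K) {B : ℝ} (hB : 0 < B) (hKB : ∀ x, |K x| ≤ B) (hfm : Measurable f)
    (hf0 : ∀ x, 0 ≤ f x) (hf : Integrable f) {A : ℝ} (hfA : ∀ x, f x ≤ A) {D : ℝ≥0∞}
    (hD : ∀ ξ ≠ 0, ‖𝓕 (fun x => (K x : ℂ)) ξ‖ₑ ≤ D) :
    ∫⁻ x, ‖∫ y, f y * K (x - y)‖ₑ ^ (8 / 3 : ℝ) ≤
      32 * D ^ (2 : ℝ) * ENNReal.ofReal B ^ (2 / 3 : ℝ) *
        (∫⁻ x, ENNReal.ofReal (f x) ^ (8 / 5 : ℝ)) ^ (5 / 3 : ℝ) := by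
  have hA : 0 ≤ A := (hf0 0).trans (hfA 0)
  have hfen : ∀ x, ‖f x‖ₑ = ENNReal.ofReal (f x) := fun x => Real.enorm_of_nonneg (hf0 x)
  set N : ℝ≥0∞ := ∫⁻ x, ENNReal.ofReal (f x) ^ (8 / 5 : ℝ) with hN
  have hNtop : N ≠ ∞ := by
    have h1 : N ≤ ∫⁻ x, ENNReal.ofReal (A ^ (3 / 5 : ℝ)) * ‖f x‖ₑ := by
      refine lintegral_mono fun x => ?_
      simp only
      rw [hfen, ← ENNReal.ofReal_rpow_of_nonneg hA (by norm_num),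
        show (8 / 5 : ℝ) = 3 / 5 + 1 by norm_num,
        ENNReal.rpow_add_of_nonneg _ _ (by norm_num) (by norm_num), ENNReal.rpow_one]
      gcongr
      exact hfA x
    refine ne_top_of_le_ne_top ?_ h1
    rw [lintegral_const_mul _ hfm.enorm]
    exact ENNReal.mul_ne_top ENNReal.ofReal_ne_top hf.2.ne
  rcases eq_or_ne N 0 with hN0 | hN0
  · have h1 : ∀ᵐ x, f x = 0 := by
      rw [hN, lintegral_eq_zero_iff (by fun_prop)] at hN0
      filter_upwards [hN0] with x hx
      simp only [Pi.zero_apply, ENNReal.rpow_eq_zero_iff] at hx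
      rcases hx with h | h
      · exact le_antisymm (ENNReal.ofReal_eq_zero.1 h.1) (hf0 x)
      · norm_num at h
    have h2 : ∀ x, ∫ y, f y * K (x - y) = 0 := by
      intro x
      refine integral_eq_zero_of_ae ?_
      filter_upwards [h1] with y hy
      simp [hy]
    simp [h2]
  set n : ℝ := N.toReal with hn
  have hn0 : 0 < n := ENNReal.toReal_pos hN0 hNtop
  have hNn : N = ENNReal.ofReal n := (ENNReal.ofReal_toReal hNtop).symm
  set μ : ℝ → ℝ := fun l => (2 * B * n / l) ^ (5 / 3 : ℝ) with hμ
  have hμm : Measurable μ := by fun_prop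
  have key : ∀ l ∈ Ioi (0 : ℝ),
      ENNReal.ofReal (l ^ ((8 / 3 : ℝ) - 1)) *
        volume {x | ENNReal.ofReal l < ‖∫ y, f y * K (x - y)‖ₑ} ≤
      4 * D ^ (2 : ℝ) * ∫⁻ x, ENNReal.ofReal (l ^ (-(1 / 3) : ℝ)) *
        {x | f x ≤ μ l}.indicator (fun x => ‖f x‖ₑ ^ (2 : ℝ)) x := by
    intro l hl
    have hl0 : (0 : ℝ) < l := hl
    have hμl : 0 < μ l := by simp only [hμ]; positivity
    have hms : MeasurableSet {x | f x ≤ μ l} := measurableSet_le hfm measurable_const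
    set f1 := {x | f x ≤ μ l}.indicator f with hf1
    set f2 := {x | f x ≤ μ l}ᶜ.indicator f with hf2
    have hf1i : Integrable f1 := hf.indicator hms
    have hf2i : Integrable f2 := hf.indicator hms.compl
    have hint : ∀ (g : E3 → ℝ), Integrable g → ∀ x, Integrable fun y => g y * K (x - y) := by
      intro g hg x
      refine hg.mul_bdd (c := B) (hKm.comp (by fun_prop)).aestronglyMeasurable
        (Filter.Eventually.of_forall fun y => hKB _)
    have hsplit : ∀ x, ∫ y, f y * K (x - y) =
        (∫ y, f1 y * K (x - y)) + ∫ y, f2 y * K (x - y) := by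
      intro x
      rw [← integral_add (hint _ hf1i x) (hint _ hf2i x)]
      refine integral_congr_ae (Filter.Eventually.of_forall fun y => ?_)
      simp only
      rw [← add_mul, hf1, hf2, Set.indicator_self_add_compl_apply]
    have hfar : ∀ x, ‖∫ y, f2 y * K (x - y)‖ₑ ≤ ENNReal.ofReal (l / 2) := by
      intro x
      calc ‖∫ y, f2 y * K (x - y)‖ₑ ≤ ∫⁻ y, ‖f2 y * K (x - y)‖ₑ := enorm_integral_le_lintegral_enorm _
        _ ≤ ∫⁻ y, ENNReal.ofReal (μ l ^ (-(3 / 5) : ℝ) * B) * ENNReal.ofReal (f y) ^ (8 / 5 : ℝ) := by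
            refine lintegral_mono fun y => ?_
            simp only
            rw [enorm_mul, ENNReal.ofReal_mul (by positivity), mul_right_comm]
            have hk : ‖K (x - y)‖ₑ ≤ ENNReal.ofReal B := by
              rw [← ofReal_norm]
              exact ENNReal.ofReal_le_ofReal (hKB _)
            refine mul_le_mul' ?_ hk
            by_cases hy : f y ≤ μ l
            · have : y ∉ {x | f x ≤ μ l}ᶜ := fun h => h hy
              simp [hf2, Set.indicator_of_notMem this]
            · have hy' : y ∈ {x | f x ≤ μ l}ᶜ := hy
              push Not at hy
              rw [hf2, Set.indicator_of_mem hy', hfen, ENNReal.ofReal_rpow_of_nonneg (hf0 y) (by norm_num),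
                ← ENNReal.ofReal_mul (by positivity)]
              refine ENNReal.ofReal_le_ofReal ?_
              have hfy : 0 < f y := hμl.trans hy
              calc f y = f y ^ (-(3 / 5) : ℝ) * f y ^ (8 / 5 : ℝ) := by
                    rw [← Real.rpow_add hfy]; norm_num
                _ ≤ _ := by
                    gcongr ?_ * _
                    exact Real.rpow_le_rpow_of_nonpos hμl hy.le (by norm_num)
        _ = ENNReal.ofReal (l / 2) := by
            rw [lintegral_const_mul _ (by fun_prop), ← hN, hNn, ← ENNReal.ofReal_mul (by positivity)]
            congr 1
            simp only [hμ]
            rw [← Real.rpow_mul (by positivity)]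
            norm_num
            rw [Real.rpow_neg_one]
            field_simp
    have hsub : {x | ENNReal.ofReal l < ‖∫ y, f y * K (x - y)‖ₑ} ⊆
        {x | ENNReal.ofReal (l / 2) ^ (2 : ℝ) ≤ ‖∫ y, f1 y * K (x - y)‖ₑ ^ (2 : ℝ)} := by
      intro x hx
      simp only [Set.mem_ofPred_eq] at hx ⊢
      gcongr
      by_contra! hc
      have := (enorm_add_le (∫ y, f1 y * K (x - y)) (∫ y, f2 y * K (x - y))).trans
        (add_le_add hc.le (hfar x))
      rw [← hsplit, ← ENNReal.ofReal_add (by positivity) (by positivity), add_halves] at this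
      exact absurd hx (not_lt.2 this)
    have hf1m : Measurable f1 := hfm.indicator hms
    have hch := mul_meas_ge_le_lintegral (μ := volume)
      (((measurable_integral_mul_sub hf1m hKm).enorm).pow_const (2 : ℝ))
      (ENNReal.ofReal (l / 2) ^ (2 : ℝ))
    have hf1A : ∀ x, |f1 x| ≤ A := by
      intro x
      simp only [hf1, Set.indicator]
      split_ifs
      · rw [abs_of_nonneg (hf0 x)]; exact hfA x
      · simpa using hA
    have hL2 := lintegral_enorm_convolution_sq_le hK hKB hf1i hf1A hD
    have hle := (mul_le_mul_right (measure_mono hsub) _).trans (hch.trans hL2)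
    have hcoef : ENNReal.ofReal (l ^ ((8 / 3 : ℝ) - 1)) =
        (4 * ENNReal.ofReal (l ^ (-(1 / 3) : ℝ))) * ENNReal.ofReal (l / 2) ^ (2 : ℝ) := by
      rw [ENNReal.ofReal_rpow_of_nonneg (by positivity) (by norm_num),
        show (4 : ℝ≥0∞) = ENNReal.ofReal 4 by simp, ← ENNReal.ofReal_mul (by norm_num),
        ← ENNReal.ofReal_mul (by positivity)]
      congr 1
      rw [Real.rpow_two, div_pow, ← Real.rpow_two,
        show (8 / 3 : ℝ) - 1 = -(1 / 3) + 2 by norm_num, Real.rpow_add hl0]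
      ring
    have hf1e : ∀ x, ‖f1 x‖ₑ ^ (2 : ℝ) = {x | f x ≤ μ l}.indicator (fun x => ‖f x‖ₑ ^ (2 : ℝ)) x := by
      intro x
      simp only [hf1, Set.indicator]
      split_ifs <;> simp
    rw [hcoef, mul_assoc]
    refine (mul_le_mul_right hle _).trans (le_of_eq ?_)
    rw [lintegral_const_mul _ ((hfm.enorm.pow_const _).indicator hms), lintegral_congr hf1e]
    ring
  rw [lintegral_rpow_eq_lintegral_meas_lt volume (by norm_num)
    (measurable_integral_mul_sub hfm hKm).enorm]
  have hFm : Measurable (uncurry fun (l : ℝ) (x : E3) => ENNReal.ofReal (l ^ (-(1 / 3) : ℝ)) *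
      {x | f x ≤ μ l}.indicator (fun x => ‖f x‖ₑ ^ (2 : ℝ)) x) := by
    have h1 : MeasurableSet {q : ℝ × E3 | f q.2 ≤ μ q.1} :=
      measurableSet_le (hfm.comp measurable_snd) (hμm.comp measurable_fst)
    have h2 : Measurable fun q : ℝ × E3 => ‖f q.2‖ₑ ^ (2 : ℝ) :=
      ((hfm.comp measurable_snd).enorm).pow_const _
    have h3 : Measurable fun q : ℝ × E3 => ENNReal.ofReal (q.1 ^ (-(1 / 3) : ℝ)) := by fun_prop
    exact h3.mul (h2.indicator h1)
  have hinner : ∀ x, ∫⁻ l in Ioi (0 : ℝ), ENNReal.ofReal (l ^ (-(1 / 3) : ℝ)) *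
      {x | f x ≤ μ l}.indicator (fun x => ‖f x‖ₑ ^ (2 : ℝ)) x ≤
      ENNReal.ofReal (3 / 2 * (2 * B * n) ^ (2 / 3 : ℝ)) * ENNReal.ofReal (f x) ^ (8 / 5 : ℝ) := by
    intro x
    rcases (hf0 x).eq_or_lt with hx | hx
    · have : ∀ l, {x | f x ≤ μ l}.indicator (fun x => ‖f x‖ₑ ^ (2 : ℝ)) x = 0 := by
        intro l
        simp only [Set.indicator, ← hx]
        simp
      simp only [this, mul_zero, lintegral_zero, zero_le]
    set ρ : ℝ := 2 * B * n * f x ^ (-(3 / 5) : ℝ) with hρ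
    have hρ0 : 0 ≤ ρ := by positivity
    have hpt : ∀ l ∈ Ioi (0 : ℝ), ENNReal.ofReal (l ^ (-(1 / 3) : ℝ)) *
        {x | f x ≤ μ l}.indicator (fun x => ‖f x‖ₑ ^ (2 : ℝ)) x ≤
        (Ioc 0 ρ).indicator (fun l => ENNReal.ofReal (l ^ (-(1 / 3) : ℝ))) l * ‖f x‖ₑ ^ (2 : ℝ) := by
      intro l hl
      have hl0 : (0 : ℝ) < l := hl
      by_cases hxl : f x ≤ μ l
      · have hm : l ∈ Ioc 0 ρ := by
          refine ⟨hl0, ?_⟩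
          have h1 : f x ^ (3 / 5 : ℝ) ≤ 2 * B * n / l := by
            have := Real.rpow_le_rpow hx.le hxl (by norm_num : (0 : ℝ) ≤ 3 / 5)
            refine this.trans (le_of_eq ?_)
            simp only [hμ]
            rw [← Real.rpow_mul (by positivity)]
            norm_num
          have h2 : 0 < f x ^ (3 / 5 : ℝ) := by positivity
          rw [hρ, Real.rpow_neg hx.le, ← div_eq_mul_inv, le_div_iff₀ h2]
          rw [le_div_iff₀ hl0] at h1
          linarith
        rw [Set.indicator_of_mem hm, Set.indicator_of_mem (show x ∈ {x | f x ≤ μ l} from hxl)]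
      · rw [Set.indicator_of_notMem (show x ∉ {x | f x ≤ μ l} from hxl)]
        simp
    calc _ ≤ ∫⁻ l in Ioi (0 : ℝ), (Ioc 0 ρ).indicator
            (fun l => ENNReal.ofReal (l ^ (-(1 / 3) : ℝ))) l * ‖f x‖ₑ ^ (2 : ℝ) :=
          setLIntegral_mono' measurableSet_Ioi hpt
      _ ≤ ∫⁻ l, (Ioc 0 ρ).indicator
            (fun l => ENNReal.ofReal (l ^ (-(1 / 3) : ℝ))) l * ‖f x‖ₑ ^ (2 : ℝ) :=
          setLIntegral_le_lintegral _ _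
      _ = ENNReal.ofReal (3 / 2 * ρ ^ (2 / 3 : ℝ)) * ‖f x‖ₑ ^ (2 : ℝ) := by
          rw [lintegral_mul_const _ ((by fun_prop : Measurable fun l : ℝ =>
            ENNReal.ofReal (l ^ (-(1 / 3) : ℝ))).indicator measurableSet_Ioc),
            lintegral_indicator measurableSet_Ioc, lintegral_Ioc_rpow_neg_third hρ0]
      _ = _ := by
          rw [hfen, ENNReal.ofReal_rpow_of_pos hx, ENNReal.ofReal_rpow_of_pos hx,
            ← ENNReal.ofReal_mul (by positivity), ← ENNReal.ofReal_mul (by positivity)]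
          congr 1
          rw [hρ, Real.mul_rpow (by positivity) (by positivity), ← Real.rpow_mul hx.le, mul_assoc,
            mul_assoc, mul_assoc, ← Real.rpow_add hx]
          norm_num
          ring
  calc _ ≤ ENNReal.ofReal (8 / 3) * ∫⁻ l in Ioi (0 : ℝ), 4 * D ^ (2 : ℝ) *
          ∫⁻ x, ENNReal.ofReal (l ^ (-(1 / 3) : ℝ)) *
            {x | f x ≤ μ l}.indicator (fun x => ‖f x‖ₑ ^ (2 : ℝ)) x := by
        exact mul_le_mul_right (setLIntegral_mono' measurableSet_Ioi key) _
    _ = ENNReal.ofReal (8 / 3) * (4 * D ^ (2 : ℝ) * ∫⁻ x, ∫⁻ l in Ioi (0 : ℝ),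
          ENNReal.ofReal (l ^ (-(1 / 3) : ℝ)) *
            {x | f x ≤ μ l}.indicator (fun x => ‖f x‖ₑ ^ (2 : ℝ)) x) := by
        have h1 : Measurable fun l : ℝ => ∫⁻ x, ENNReal.ofReal (l ^ (-(1 / 3) : ℝ)) *
            {x | f x ≤ μ l}.indicator (fun x => ‖f x‖ₑ ^ (2 : ℝ)) x := hFm.lintegral_prod_right'
        rw [lintegral_const_mul _ h1, lintegral_lintegral_swap hFm.aemeasurable]
    _ ≤ ENNReal.ofReal (8 / 3) * (4 * D ^ (2 : ℝ) * ∫⁻ x,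
          ENNReal.ofReal (3 / 2 * (2 * B * n) ^ (2 / 3 : ℝ)) * ENNReal.ofReal (f x) ^ (8 / 5 : ℝ)) := by
        gcongr
        exact hinner _
    _ = ENNReal.ofReal (8 / 3) * (4 * D ^ (2 : ℝ) *
          (ENNReal.ofReal (3 / 2 * (2 * B * n) ^ (2 / 3 : ℝ)) * ENNReal.ofReal n)) := by
        rw [lintegral_const_mul _ (by fun_prop), ← hN, hNn]
    _ = D ^ (2 : ℝ) * ENNReal.ofReal (16 * 2 ^ (2 / 3 : ℝ) * B ^ (2 / 3 : ℝ) * n ^ (5 / 3 : ℝ)) := by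
        rw [show (4 : ℝ≥0∞) = ENNReal.ofReal 4 by simp]
        have : 16 * 2 ^ (2 / 3 : ℝ) * B ^ (2 / 3 : ℝ) * n ^ (5 / 3 : ℝ) =
            8 / 3 * 4 * (3 / 2 * (2 * B * n) ^ (2 / 3 : ℝ)) * n := by
          rw [show (5 / 3 : ℝ) = 2 / 3 + 1 by norm_num, Real.rpow_add hn0, Real.rpow_one,
            Real.mul_rpow (by positivity) (by positivity), Real.mul_rpow (by positivity) (by positivity)]
          ring
        have hX : 0 ≤ 3 / 2 * (2 * B * n) ^ (2 / 3 : ℝ) := by positivity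
        rw [this]
        generalize 3 / 2 * (2 * B * n) ^ (2 / 3 : ℝ) = X at hX
        rw [ENNReal.ofReal_mul (by positivity), ENNReal.ofReal_mul (by positivity),
          ENNReal.ofReal_mul (by positivity)]
        ring
    _ ≤ D ^ (2 : ℝ) * ENNReal.ofReal (32 * B ^ (2 / 3 : ℝ) * n ^ (5 / 3 : ℝ)) := by
        gcongr
        have : (2 : ℝ) ^ (2 / 3 : ℝ) ≤ 2 ^ (1 : ℝ) :=
          Real.rpow_le_rpow_of_exponent_le (by norm_num) (by norm_num)
        rw [Real.rpow_one] at this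
        linarith
    _ = _ := by
        rw [hNn, ENNReal.ofReal_rpow_of_pos hB, ENNReal.ofReal_rpow_of_pos hn0,
          ENNReal.ofReal_mul (by positivity), ENNReal.ofReal_mul (by positivity)]
        simp only [ENNReal.ofReal_ofNat]
        ring

theorem lintegral_enorm_convolution_pow_four_le {K f : E3 → ℝ} (hKm : Measurable K)
    (hK : Integrable K) {B : ℝ} (hB : 0 < B) (hKB : ∀ x, |K x| ≤ B) (hfm : Measurable f)
    (hf0 : ∀ x, 0 ≤ f x) (hf : Integrable f) {A : ℝ} (hfA : ∀ x, f x ≤ A) {D : ℝ≥0∞}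
    (hD : ∀ ξ ≠ 0, ‖𝓕 (fun x => (K x : ℂ)) ξ‖ₑ ≤ D) {s : Set E3} (hs : MeasurableSet s)
    (hKs : ∀ x ∉ s, K x = 0) {V : ℝ≥0∞} (hV : volume s ≤ V) :
    ∫⁻ x, ‖∫ y, f y * K (x - y)‖ₑ ^ (4 : ℝ) ≤
      32 * D ^ (2 : ℝ) * ENNReal.ofReal B ^ (2 : ℝ) * V ^ (1 / 2 : ℝ) *
        (∫⁻ x, ENNReal.ofReal (f x) ^ (8 / 5 : ℝ)) ^ (5 / 2 : ℝ) := by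
  set N : ℝ≥0∞ := ∫⁻ x, ENNReal.ofReal (f x) ^ (8 / 5 : ℝ) with hN
  set b := ENNReal.ofReal B with hb
  have hsup : ∀ x, ‖∫ y, f y * K (x - y)‖ₑ ≤ N ^ (5 / 8 : ℝ) * (b ^ (8 / 3 : ℝ) * V) ^ (3 / 8 : ℝ) := by
    intro x
    have hKx : Measurable fun y => ‖K (x - y)‖ₑ := (hKm.comp (by fun_prop)).enorm
    have hpq : (8 / 5 : ℝ).HolderConjugate (8 / 3) := by
      rw [Real.holderConjugate_iff]; norm_num
    calc ‖∫ y, f y * K (x - y)‖ₑ ≤ ∫⁻ y, ‖f y * K (x - y)‖ₑ := enorm_integral_le_lintegral_enorm _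
      _ = ∫⁻ y, ((fun y => ‖f y‖ₑ) * fun y => ‖K (x - y)‖ₑ) y := by
          simp only [enorm_mul, Pi.mul_apply]
      _ ≤ (∫⁻ y, ‖f y‖ₑ ^ (8 / 5 : ℝ)) ^ (1 / (8 / 5) : ℝ) *
          (∫⁻ y, ‖K (x - y)‖ₑ ^ (8 / 3 : ℝ)) ^ (1 / (8 / 3) : ℝ) :=
          ENNReal.lintegral_mul_le_Lp_mul_Lq volume hpq hfm.enorm.aemeasurable hKx.aemeasurable
      _ ≤ N ^ (5 / 8 : ℝ) * (b ^ (8 / 3 : ℝ) * V) ^ (3 / 8 : ℝ) := by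
          rw [show (1 / (8 / 5) : ℝ) = 5 / 8 by norm_num, show (1 / (8 / 3) : ℝ) = 3 / 8 by norm_num]
          gcongr
          · exact le_of_eq (lintegral_congr fun y => by rw [Real.enorm_of_nonneg (hf0 y)])
          · rw [lintegral_sub_left_eq_self (fun y => ‖K y‖ₑ ^ (8 / 3 : ℝ)) x]
            calc ∫⁻ y, ‖K y‖ₑ ^ (8 / 3 : ℝ) ≤ ∫⁻ y, s.indicator (fun _ => b ^ (8 / 3 : ℝ)) y := by
                  refine lintegral_mono fun y => ?_
                  by_cases hy : y ∈ s
                  · rw [Set.indicator_of_mem hy]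
                    refine ENNReal.rpow_le_rpow ?_ (by norm_num)
                    rw [← ofReal_norm]
                    exact ENNReal.ofReal_le_ofReal (hKB _)
                  · simp [hKs y hy]
              _ ≤ b ^ (8 / 3 : ℝ) * V := by
                  rw [lintegral_indicator_const hs]
                  gcongr
  calc ∫⁻ x, ‖∫ y, f y * K (x - y)‖ₑ ^ (4 : ℝ)
      ≤ ∫⁻ x, (N ^ (5 / 8 : ℝ) * (b ^ (8 / 3 : ℝ) * V) ^ (3 / 8 : ℝ)) ^ (4 / 3 : ℝ) *
          ‖∫ y, f y * K (x - y)‖ₑ ^ (8 / 3 : ℝ) := by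
        refine lintegral_mono fun x => ?_
        simp only
        rw [show (4 : ℝ) = 4 / 3 + 8 / 3 by norm_num,
          ENNReal.rpow_add_of_nonneg _ _ (by norm_num) (by norm_num)]
        norm_num
        gcongr
        exact hsup x
    _ = (N ^ (5 / 8 : ℝ) * (b ^ (8 / 3 : ℝ) * V) ^ (3 / 8 : ℝ)) ^ (4 / 3 : ℝ) *
          ∫⁻ x, ‖∫ y, f y * K (x - y)‖ₑ ^ (8 / 3 : ℝ) := by
        rw [lintegral_const_mul _ ((measurable_integral_mul_sub hfm hKm).enorm.pow_const _)]
    _ ≤ (N ^ (5 / 8 : ℝ) * (b ^ (8 / 3 : ℝ) * V) ^ (3 / 8 : ℝ)) ^ (4 / 3 : ℝ) *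
          (32 * D ^ (2 : ℝ) * b ^ (2 / 3 : ℝ) * N ^ (5 / 3 : ℝ)) := by
        gcongr
        exact lintegral_enorm_convolution_rpow_le hKm hK hB hKB hfm hf0 hf hfA hD
    _ = 32 * D ^ (2 : ℝ) * (b ^ (4 / 3 : ℝ) * b ^ (2 / 3 : ℝ)) * V ^ (1 / 2 : ℝ) *
          (N ^ (5 / 6 : ℝ) * N ^ (5 / 3 : ℝ)) := by
        rw [ENNReal.mul_rpow_of_nonneg _ _ (by norm_num), ← ENNReal.rpow_mul, ← ENNReal.rpow_mul,
          ENNReal.mul_rpow_of_nonneg _ _ (by norm_num), ← ENNReal.rpow_mul]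
        norm_num
        ring
    _ = _ := by
        rw [← ENNReal.rpow_add_of_nonneg _ _ (by norm_num) (by norm_num),
          ← ENNReal.rpow_add_of_nonneg _ _ (by norm_num) (by norm_num)]
        norm_num

/-- The normalised indicator of the spherical shell of thickness `h` about the unit sphere. -/
def annKer (h : ℝ) : E3 → ℝ := fun x => h⁻¹ * ((Metric.ball 0 (1 + h)).indicator (fun _ => (1 : ℝ)) x -
  (Metric.ball 0 1).indicator (fun _ => (1 : ℝ)) x)

theorem annKer_eq_indicator {h : ℝ} (hh : 0 < h) :
    annKer h = (Metric.ball 0 (1 + h) \ Metric.ball 0 1).indicator (fun _ => h⁻¹) := by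
  funext x
  have hsub : Metric.ball (0 : E3) 1 ⊆ Metric.ball 0 (1 + h) := Metric.ball_subset_ball (by linarith)
  by_cases h1 : x ∈ Metric.ball (0 : E3) 1
  · have h2 := hsub h1
    rw [annKer, Set.indicator_of_mem h1, Set.indicator_of_mem h2, Set.indicator_of_notMem (by simp [h1])]
    simp
  · by_cases h2 : x ∈ Metric.ball (0 : E3) (1 + h)
    · rw [annKer, Set.indicator_of_notMem h1, Set.indicator_of_mem h2, Set.indicator_of_mem (show x ∈ _ \ _ from ⟨h2, h1⟩)]
      simp
    · rw [annKer, Set.indicator_of_notMem h1, Set.indicator_of_notMem h2,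
        Set.indicator_of_notMem (fun h => h2 h.1)]
      simp

theorem measurable_annKer (h : ℝ) : Measurable (annKer h) := by
  refine measurable_const.mul (Measurable.sub ?_ ?_) <;>
  exact measurable_const.indicator measurableSet_ball

theorem annKer_mem_Icc {h : ℝ} (hh : 0 < h) (x : E3) : annKer h x ∈ Icc 0 h⁻¹ := by
  have := inv_pos.2 hh
  rw [annKer_eq_indicator hh, Set.indicator]
  split_ifs
  · exact ⟨this.le, le_rfl⟩
  · exact ⟨le_rfl, this.le⟩

theorem integrable_indicator_ball (R : ℝ) :
    Integrable ((Metric.ball (0 : E3) R).indicator (fun _ => (1 : ℝ))) :=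
  (integrable_indicator_iff measurableSet_ball).2 (integrableOn_const measure_ball_lt_top.ne)

theorem integrable_annKer (h : ℝ) : Integrable (annKer h) :=
  ((integrable_indicator_ball _).sub (integrable_indicator_ball _)).const_mul _

theorem volume_shell_le {h : ℝ} (hh : 0 < h) (hh1 : h ≤ 1) :
    volume (Metric.ball (0 : E3) (1 + h) \ Metric.ball 0 1) ≤ ENNReal.ofReal (30 * h) := by
  rw [measure_sdiff (Metric.ball_subset_ball (by linarith)) measurableSet_ball.nullMeasurableSet
    measure_ball_lt_top.ne, EuclideanSpace.volume_ball_fin_three,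
    EuclideanSpace.volume_ball_fin_three, ← ENNReal.ofReal_pow (by linarith),
    ← ENNReal.ofReal_pow (by linarith), ← ENNReal.ofReal_mul (by positivity),
    ← ENNReal.ofReal_mul (by positivity), ← ENNReal.ofReal_sub _ (by positivity)]
  refine ENNReal.ofReal_le_ofReal ?_
  have h1 : (1 + h) ^ 3 - 1 ≤ 7 * h := by nlinarith [mul_pos hh hh, pow_pos hh 3]
  have h2 : 0 ≤ (1 + h) ^ 3 - 1 := by nlinarith [mul_pos hh hh, pow_pos hh 3]
  nlinarith [Real.pi_lt_four, Real.pi_pos, Real.pi_lt_d2]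

theorem enorm_fourier_annKer_sub_le {h : ℝ} (hh : 0 < h) (hh1 : h ≤ 1 / 2) {ξ : E3} (hξ : ξ ≠ 0) :
    ‖𝓕 (fun x => ((annKer h x - annKer (2 * h) x : ℝ) : ℂ)) ξ‖ₑ ≤ ENNReal.ofReal (8 * π * h) := by
  set I : ℝ → E3 → ℂ := fun R x => (((Metric.ball 0 R).indicator (fun _ => (1 : ℝ)) x : ℝ) : ℂ) with hI
  have hIi : ∀ R, Integrable (fun x => Complex.exp (((-2 * π * inner ℝ x ξ : ℝ) : ℂ) * Complex.I) • I R x) := by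
    intro R
    refine ((integrable_indicator_ball R).ofReal (𝕜 := ℂ)).bdd_mul (c := 1)
      (by fun_prop : Continuous _).aestronglyMeasurable (Filter.Eventually.of_forall fun x => ?_)
    rw [Complex.norm_exp_ofReal_mul_I]
  have hFI : ∀ R, 0 ≤ R → ∫ x, Complex.exp (((-2 * π * inner ℝ x ξ : ℝ) : ℂ) * Complex.I) • I R x =
      ballHat (((-(2 * π * ‖ξ‖) : ℝ) : ℂ) * Complex.I) R := by
    intro R hR
    rw [← Real.fourier_eq', hI, fourier_indicator_ball hR hξ]
    push_cast
    rfl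
  have hsub : Integrable (fun x =>
      Complex.exp (((-2 * π * inner ℝ x ξ : ℝ) : ℂ) * Complex.I) • I (1 + 2 * h) x -
      2 * Complex.exp (((-2 * π * inner ℝ x ξ : ℝ) : ℂ) * Complex.I) • I (1 + h) x) :=
    (hIi _).sub ((hIi _).const_mul _)
  have e : 𝓕 (fun x => ((annKer h x - annKer (2 * h) x : ℝ) : ℂ)) ξ =
      (-((2 * h)⁻¹ : ℝ) : ℂ) * (ballHat (((-(2 * π * ‖ξ‖) : ℝ) : ℂ) * Complex.I) (1 + 2 * h) -
        2 * ballHat (((-(2 * π * ‖ξ‖) : ℝ) : ℂ) * Complex.I) (1 + h) +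
        ballHat (((-(2 * π * ‖ξ‖) : ℝ) : ℂ) * Complex.I) 1) := by
    rw [Real.fourier_eq', ← hFI _ (by positivity), ← hFI _ (by positivity), ← hFI _ (by positivity),
      ← integral_const_mul, ← integral_sub (hIi _) ((hIi _).const_mul _),
      ← integral_add hsub (hIi _), ← integral_const_mul]
    refine integral_congr_ae (Filter.Eventually.of_forall fun x => ?_)
    simp only [annKer, hI, smul_eq_mul]
    push_cast
    have : (h : ℂ) ≠ 0 := by exact_mod_cast hh.ne'
    field_simp
    ring
  rw [e, ← ofReal_norm]
  refine ENNReal.ofReal_le_ofReal ?_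
  have hk : (-(2 * π * ‖ξ‖) : ℝ) ≠ 0 := by simp [hξ, Real.pi_ne_zero]
  have := norm_ballHat_second_difference_le hk (a := 1) (h := h) (M := 2) (by norm_num) hh.le
    (by linarith)
  rw [norm_mul]
  have h2 : ‖(-((2 * h)⁻¹ : ℝ) : ℂ)‖ = (2 * h)⁻¹ := by
    rw [norm_neg, Complex.norm_real, Real.norm_of_nonneg (by positivity)]
  rw [h2]
  calc (2 * h)⁻¹ * _ ≤ (2 * h)⁻¹ * (8 * π * 2 * h ^ 2) := by gcongr
    _ = 8 * π * h := by field_simp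

theorem lintegral_annKer_sub_rpow_le {f : E3 → ℝ} (hfm : Measurable f) (hf0 : ∀ x, 0 ≤ f x)
    (hf : Integrable f) {A : ℝ} (hfA : ∀ x, f x ≤ A) {h : ℝ} (hh : 0 < h) (hh1 : h ≤ 1 / 2) :
    (∫⁻ x, ‖∫ y, f y * (annKer h (x - y) - annKer (2 * h) (x - y))‖ₑ ^ (4 : ℝ)) ^ (1 / 4 : ℝ) ≤
      (163840 : ℝ≥0∞) ^ (1 / 4 : ℝ) * ENNReal.ofReal h ^ (1 / 8 : ℝ) *
        (∫⁻ x, ENNReal.ofReal (f x) ^ (8 / 5 : ℝ)) ^ (5 / 8 : ℝ) := by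
  have hKm : Measurable fun x => annKer h x - annKer (2 * h) x :=
    (measurable_annKer _).sub (measurable_annKer _)
  have hK := (integrable_annKer h).sub (integrable_annKer (2 * h))
  have hKB : ∀ x, |annKer h x - annKer (2 * h) x| ≤ h⁻¹ := by
    intro x
    have h1 := annKer_mem_Icc hh x
    have h2 := annKer_mem_Icc (h := 2 * h) (by linarith) x
    have h3 : (2 * h)⁻¹ ≤ h⁻¹ := inv_anti₀ hh (by linarith)
    exact abs_le.2 ⟨by linarith [h1.1, h2.2], by linarith [h1.2, h2.1]⟩
  have hKs : ∀ x ∉ Metric.ball (0 : E3) (1 + 2 * h) \ Metric.ball 0 1,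
      annKer h x - annKer (2 * h) x = 0 := by
    intro x hx
    have hx' : x ∉ Metric.ball (0 : E3) (1 + h) \ Metric.ball 0 1 := fun hc =>
      hx ⟨Metric.ball_subset_ball (by linarith) hc.1, hc.2⟩
    rw [annKer_eq_indicator hh, annKer_eq_indicator (by linarith : 0 < 2 * h),
      Set.indicator_of_notMem hx, Set.indicator_of_notMem hx', sub_zero]
  have := lintegral_enorm_convolution_pow_four_le hKm hK (inv_pos.2 hh) hKB hfm hf0 hf hfA
    (fun ξ hξ => enorm_fourier_annKer_sub_le hh hh1 hξ)
    (measurableSet_ball.diff measurableSet_ball) hKs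
    (volume_shell_le (h := 2 * h) (by linarith) (by linarith))
  refine (ENNReal.rpow_le_rpow this (by norm_num)).trans ?_
  have hc : 32 * ENNReal.ofReal (8 * π * h) ^ (2 : ℝ) * ENNReal.ofReal h⁻¹ ^ (2 : ℝ) *
      ENNReal.ofReal (30 * (2 * h)) ^ (1 / 2 : ℝ) ≤ 163840 * ENNReal.ofReal h ^ (1 / 2 : ℝ) := by
    rw [ENNReal.ofReal_rpow_of_pos (by positivity), ENNReal.ofReal_rpow_of_pos (by positivity),
      ENNReal.ofReal_rpow_of_pos (by positivity), ENNReal.ofReal_rpow_of_pos (by positivity),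
      show (32 : ℝ≥0∞) = ENNReal.ofReal 32 by simp,
      show (163840 : ℝ≥0∞) = ENNReal.ofReal 163840 by simp, ← ENNReal.ofReal_mul (by positivity),
      ← ENNReal.ofReal_mul (by positivity), ← ENNReal.ofReal_mul (by positivity),
      ← ENNReal.ofReal_mul (by positivity)]
    refine ENNReal.ofReal_le_ofReal ?_
    have e60 : (60 * h) ^ (1 / 2 : ℝ) = 60 ^ (1 / 2 : ℝ) * h ^ (1 / 2 : ℝ) :=
      Real.mul_rpow (by norm_num) hh.le
    rw [show 30 * (2 * h) = 60 * h by ring, e60]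
    have h60 : (60 : ℝ) ^ (1 / 2 : ℝ) ≤ 8 := by
      rw [← Real.sqrt_eq_rpow, Real.sqrt_le_left (by norm_num)]
      norm_num
    have hpi : π ^ 2 ≤ 10 := by nlinarith [Real.pi_lt_d2, Real.pi_pos]
    have hx : 0 ≤ h ^ (1 / 2 : ℝ) := by positivity
    calc 32 * (8 * π * h) ^ (2 : ℝ) * h⁻¹ ^ (2 : ℝ) * (60 ^ (1 / 2 : ℝ) * h ^ (1 / 2 : ℝ))
        = 2048 * (π ^ 2 * 60 ^ (1 / 2 : ℝ)) * h ^ (1 / 2 : ℝ) := by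
          rw [Real.rpow_two, Real.rpow_two]
          field_simp
          ring
      _ ≤ 2048 * (10 * 8) * h ^ (1 / 2 : ℝ) := by gcongr
      _ = _ := by ring
  calc _ ≤ (163840 * ENNReal.ofReal h ^ (1 / 2 : ℝ) *
        (∫⁻ x, ENNReal.ofReal (f x) ^ (8 / 5 : ℝ)) ^ (5 / 2 : ℝ)) ^ (1 / 4 : ℝ) := by gcongr
    _ = _ := by
      rw [ENNReal.mul_rpow_of_nonneg _ _ (by norm_num), ENNReal.mul_rpow_of_nonneg _ _ (by norm_num),
        ← ENNReal.rpow_mul, ← ENNReal.rpow_mul]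
      norm_num

theorem exists_annKer_bound : ∃ C : ℝ≥0∞, C ≠ ∞ ∧ ∀ f : E3 → ℝ, Measurable f → (∀ x, 0 ≤ f x) →
    Integrable f → ∀ A : ℝ, (∀ x, f x ≤ A) → ∀ n : ℕ,
    (∫⁻ x, ‖∫ y, f y * annKer ((1 / 2) ^ (n + 1)) (x - y)‖ₑ ^ (4 : ℝ)) ^ (1 / 4 : ℝ) ≤
      C * (∫⁻ x, ENNReal.ofReal (f x) ^ (8 / 5 : ℝ)) ^ (5 / 8 : ℝ) := by
  set D : ℝ≥0∞ := ∫⁻ x, ‖annKer (1 / 2) x‖ₑ with hD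
  have hDtop : D ≠ ∞ := (integrable_annKer (1 / 2)).2.ne
  set c0 : ℝ≥0∞ := (32 * D ^ (2 : ℝ) * ENNReal.ofReal (1 / 2)⁻¹ ^ (2 : ℝ) *
    ENNReal.ofReal (30 * (1 / 2)) ^ (1 / 2 : ℝ)) ^ (1 / 4 : ℝ) with hc0
  have hc0top : c0 ≠ ∞ := by
    refine ENNReal.rpow_ne_top_of_nonneg (by norm_num) (ENNReal.mul_ne_top (ENNReal.mul_ne_top
      (ENNReal.mul_ne_top (by simp) ?_) ?_) ?_) <;>
    refine ENNReal.rpow_ne_top_of_nonneg (by norm_num) ?_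
    · exact hDtop
    · exact ENNReal.ofReal_ne_top
    · exact ENNReal.ofReal_ne_top
  set c1 : ℝ≥0∞ := (163840 : ℝ≥0∞) ^ (1 / 4 : ℝ) with hc1
  have hc1top : c1 ≠ ∞ := ENNReal.rpow_ne_top_of_nonneg (by norm_num) (by simp)
  set r : ℝ≥0∞ := ENNReal.ofReal (1 / 2) ^ (1 / 8 : ℝ) with hr
  have hr1 : r < 1 := ENNReal.rpow_lt_one (by rw [ENNReal.ofReal_lt_one]; norm_num) (by norm_num)
  refine ⟨c0 + c1 * ∑' i, r ^ i, ?_, ?_⟩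
  · rw [ENNReal.tsum_geometric]
    exact ENNReal.add_ne_top.2 ⟨hc0top, ENNReal.mul_ne_top hc1top
      (ENNReal.inv_ne_top.2 (tsub_pos_of_lt hr1).ne')⟩
  intro f hfm hf0 hf A hfA n
  set N : ℝ≥0∞ := ∫⁻ x, ENNReal.ofReal (f x) ^ (8 / 5 : ℝ) with hN
  suffices h : (∫⁻ x, ‖∫ y, f y * annKer ((1 / 2) ^ (n + 1)) (x - y)‖ₑ ^ (4 : ℝ)) ^ (1 / 4 : ℝ) ≤
      (c0 + c1 * ∑ i ∈ Finset.range n, r ^ i) * N ^ (5 / 8 : ℝ) by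
    refine h.trans ?_
    gcongr
    exact ENNReal.sum_le_tsum _
  induction n with
  | zero =>
    have hKB : ∀ x, |annKer (1 / 2) x| ≤ (1 / 2)⁻¹ := by
      intro x
      have h1 := annKer_mem_Icc (h := 1 / 2) (by norm_num) x
      rw [abs_of_nonneg h1.1]
      exact h1.2
    have hKs : ∀ x ∉ Metric.ball (0 : E3) (1 + 1 / 2) \ Metric.ball 0 1, annKer (1 / 2) x = 0 := by
      intro x hx
      rw [annKer_eq_indicator (by norm_num), Set.indicator_of_notMem hx]
    have hDF : ∀ ξ ≠ 0, ‖𝓕 (fun x => (annKer (1 / 2) x : ℂ)) ξ‖ₑ ≤ D := by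
      intro ξ _
      rw [Real.fourier_eq']
      refine (enorm_integral_le_lintegral_enorm _).trans (le_of_eq (lintegral_congr fun x => ?_))
      rw [enorm_smul, ← ofReal_norm, Complex.norm_exp_ofReal_mul_I, ← ofReal_norm, Complex.norm_real,
        ← ofReal_norm, ENNReal.ofReal_one, one_mul]
    have := lintegral_enorm_convolution_pow_four_le (measurable_annKer _) (integrable_annKer (1 / 2))
      (by norm_num) hKB hfm hf0 hf hfA hDF (measurableSet_ball.diff measurableSet_ball) hKs
      (volume_shell_le (h := 1 / 2) (by norm_num) (by norm_num))
    have := ENNReal.rpow_le_rpow this (by norm_num : (0 : ℝ) ≤ 1 / 4)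
    rw [ENNReal.mul_rpow_of_nonneg _ _ (by norm_num), ← ENNReal.rpow_mul, ← hc0] at this
    norm_num at this ⊢
    exact this
  | succ n ih =>
    set h : ℝ := (1 / 2) ^ (n + 1 + 1) with hh
    have hh0 : 0 < h := by positivity
    have hh1 : h ≤ 1 / 2 := by
      rw [hh, pow_succ]
      have : ((1 : ℝ) / 2) ^ (n + 1) ≤ 1 := pow_le_one₀ (by norm_num) (by norm_num)
      linarith
    have hh2 : 2 * h = (1 / 2) ^ (n + 1) := by rw [hh, pow_succ]; ring
    have hint : ∀ h : ℝ, 0 < h → ∀ x, Integrable fun y => f y * annKer h (x - y) := by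
      intro h hh x
      refine hf.mul_bdd (c := h⁻¹) ((measurable_annKer h).comp (by fun_prop)).aestronglyMeasurable
        (Filter.Eventually.of_forall fun y => ?_)
      have h1 := annKer_mem_Icc hh (x - y)
      rw [Real.norm_of_nonneg h1.1]
      exact h1.2
    have hsplit : ∀ x, ∫ y, f y * annKer h (x - y) =
        (∫ y, f y * annKer (2 * h) (x - y)) +
          ∫ y, f y * (annKer h (x - y) - annKer (2 * h) (x - y)) := by
      intro x
      have := integral_sub (hint h hh0 x) (hint (2 * h) (by linarith) x)
      simp only [mul_sub]
      rw [this]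
      ring
    have hm1 := (measurable_integral_mul_sub hfm (measurable_annKer (2 * h))).enorm
    have hm2 := (measurable_integral_mul_sub hfm
      ((measurable_annKer h).sub (measurable_annKer (2 * h)))).enorm
    have hLp := ENNReal.lintegral_Lp_add_le (μ := volume) (p := 4) hm1.aemeasurable hm2.aemeasurable
      (by norm_num)
    rw [← hh2] at ih
    have hrh : ENNReal.ofReal h ^ (1 / 8 : ℝ) ≤ r ^ n := by
      rw [hr, ← ENNReal.rpow_natCast, ← ENNReal.rpow_mul, mul_comm, ENNReal.rpow_mul,
        ENNReal.rpow_natCast, ← ENNReal.ofReal_pow (by norm_num)]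
      gcongr
      exact pow_le_pow_of_le_one (by norm_num) (by norm_num) (by omega)
    calc _ ≤ (∫⁻ x, (‖∫ y, f y * annKer (2 * h) (x - y)‖ₑ +
          ‖∫ y, f y * (annKer h (x - y) - annKer (2 * h) (x - y))‖ₑ) ^ (4 : ℝ)) ^ (1 / 4 : ℝ) := by
          gcongr with x
          rw [hsplit]
          exact enorm_add_le _ _
      _ ≤ _ := hLp
      _ ≤ (c0 + c1 * ∑ i ∈ Finset.range n, r ^ i) * N ^ (5 / 8 : ℝ) +
          c1 * r ^ n * N ^ (5 / 8 : ℝ) := by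
          refine add_le_add ih ((lintegral_annKer_sub_rpow_le hfm hf0 hf hfA hh0 hh1).trans ?_)
          gcongr
      _ = _ := by
          rw [Finset.sum_range_succ]
          ring

theorem le_enorm_integral_mul_annKer {f : E3 → ℝ} (hfm : Measurable f) (hf0 : ∀ x, 0 ≤ f x)
    (hf : Integrable f) {h : ℝ} (hh : 0 < h) (x : E3) {c : ℝ≥0∞}
    (hc : ∀ r ∈ Ico 1 (1 + h), c ≤ sphMean (fun y => ENNReal.ofReal (f y)) r x) :
    c ≤ ‖∫ y, f y * annKer h (x - y)‖ₑ := by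
  have hk0 : ∀ z, 0 ≤ annKer h z := fun z => (annKer_mem_Icc hh z).1
  have hint : Integrable fun y => f y * annKer h (x - y) := by
    refine hf.mul_bdd (c := h⁻¹) ((measurable_annKer h).comp (by fun_prop)).aestronglyMeasurable
      (Filter.Eventually.of_forall fun y => ?_)
    rw [Real.norm_of_nonneg (hk0 _)]
    exact (annKer_mem_Icc hh _).2
  have hpos : ∀ y, 0 ≤ f y * annKer h (x - y) := fun y => mul_nonneg (hf0 y) (hk0 _)
  have hm : Measurable fun z => ENNReal.ofReal (f (x + z) * annKer h (-z)) :=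
    ENNReal.measurable_ofReal.comp ((hfm.comp (by fun_prop)).mul
      ((measurable_annKer h).comp (by fun_prop)))
  have e1 : ∀ z : E3, x - (x + z) = -z := fun z => by abel
  rw [Real.enorm_eq_ofReal (integral_nonneg hpos),
    ofReal_integral_eq_lintegral_ofReal hint (Filter.Eventually.of_forall hpos),
    ← lintegral_add_left_eq_self _ x]
  simp only [e1]
  rw [lintegral_eq_lintegral_sphereMeasure hm]
  have hker : ∀ r ∈ Ico 1 (1 + h), ∀ ω : Metric.sphere (0 : E3) 1,
      annKer h (-(r • (ω : E3))) = h⁻¹ := by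
    intro r hr ω
    have hn : ‖-(r • (ω : E3))‖ = r := by
      rw [norm_neg, norm_smul, Real.norm_of_nonneg (by linarith [hr.1])]
      simp
    rw [annKer_eq_indicator hh, Set.indicator_of_mem]
    simp only [Set.mem_sdiff, Metric.mem_ball, dist_zero_right, hn]
    exact ⟨hr.2, not_lt.2 hr.1⟩
  calc c = ∫⁻ r in Ico 1 (1 + h), c * ENNReal.ofReal h⁻¹ := by
        rw [setLIntegral_const, Real.volume_Ico, add_sub_cancel_left, mul_assoc,
          ← ENNReal.ofReal_mul (by positivity), inv_mul_cancel₀ hh.ne', ENNReal.ofReal_one, mul_one]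
    _ ≤ ∫⁻ r in Ico 1 (1 + h), ENNReal.ofReal (r ^ 2) *
          ∫⁻ ω, ENNReal.ofReal (f (x + r • (ω : E3)) * annKer h (-(r • (ω : E3)))) ∂sphereMeasure := by
        refine setLIntegral_mono' measurableSet_Ico fun r hr => ?_
        have h1 : (∫⁻ ω, ENNReal.ofReal (f (x + r • (ω : E3)) * annKer h (-(r • (ω : E3))))
            ∂sphereMeasure) = sphMean (fun y => ENNReal.ofReal (f y)) r x * ENNReal.ofReal h⁻¹ := by
          rw [sphMean, ← lintegral_mul_const' _ _ ENNReal.ofReal_ne_top]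
          refine lintegral_congr fun ω => ?_
          rw [hker r hr, ENNReal.ofReal_mul (hf0 _)]
        have h2 : 1 ≤ ENNReal.ofReal (r ^ 2) := ENNReal.one_le_ofReal.2 (by nlinarith [hr.1])
        rw [h1]
        calc c * ENNReal.ofReal h⁻¹ = 1 * (c * ENNReal.ofReal h⁻¹) := (one_mul _).symm
          _ ≤ _ := by gcongr; exact hc r hr
    _ ≤ _ := lintegral_mono_set fun r hr => lt_of_lt_of_le one_pos hr.1

theorem continuous_sphMean {f : E3 → ℝ} (hfc : Continuous f) {A : ℝ} (hfA : ∀ x, f x ≤ A) (x : E3) :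
    Continuous fun r => sphMean (fun y => ENNReal.ofReal (f y)) r x := by
  rw [continuous_iff_continuousAt]
  intro r
  refine tendsto_lintegral_filter_of_dominated_convergence (fun _ => ENNReal.ofReal A)
    (Filter.Eventually.of_forall fun s => ?_) (Filter.Eventually.of_forall fun s =>
      Filter.Eventually.of_forall fun ω => ENNReal.ofReal_le_ofReal (hfA _)) ?_
    (Filter.Eventually.of_forall fun ω => ?_)
  · exact (ENNReal.continuous_ofReal.comp (hfc.comp (by fun_prop))).measurable
  · rw [lintegral_const]
    exact ENNReal.mul_ne_top ENNReal.ofReal_ne_top (measure_ne_top _ _)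
  · have : Continuous fun s : ℝ => ENNReal.ofReal (f (x + s • (ω : E3))) :=
      ENNReal.continuous_ofReal.comp (hfc.comp (by fun_prop))
    exact this.tendsto r

theorem measurable_sphMean {F : E3 → ℝ≥0∞} (hF : Measurable F) :
    Measurable fun q : ℝ × E3 => sphMean F q.1 q.2 := by
  have : Measurable fun p : (ℝ × E3) × Metric.sphere (0 : E3) 1 => F (p.1.2 + p.1.1 • (p.2 : E3)) :=
    hF.comp (by fun_prop)
  exact this.lintegral_prod_right'

theorem exists_sphMean_one_bound : ∃ C : ℝ≥0∞, C ≠ ∞ ∧ ∀ f : E3 → ℝ, Continuous f →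
    (∀ x, 0 ≤ f x) → Integrable f → ∀ A : ℝ, (∀ x, f x ≤ A) →
    ∫⁻ x, sphMean (fun y => ENNReal.ofReal (f y)) 1 x ^ (4 : ℝ) ≤
      C * (∫⁻ x, ENNReal.ofReal (f x) ^ (8 / 5 : ℝ)) ^ (5 / 2 : ℝ) := by
  obtain ⟨C, hC, hb⟩ := exists_annKer_bound
  refine ⟨C ^ (4 : ℝ), ENNReal.rpow_ne_top_of_nonneg (by norm_num) hC, ?_⟩
  intro f hfc hf0 hf A hfA
  set N : ℝ≥0∞ := ∫⁻ x, ENNReal.ofReal (f x) ^ (8 / 5 : ℝ) with hN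
  have hb' : ∀ n : ℕ, ∫⁻ x, ‖∫ y, f y * annKer ((1 / 2) ^ (n + 1)) (x - y)‖ₑ ^ (4 : ℝ) ≤
      C ^ (4 : ℝ) * N ^ (5 / 2 : ℝ) := by
    intro n
    have := ENNReal.rpow_le_rpow (hb f hfc.measurable hf0 hf A hfA n) (by norm_num : (0 : ℝ) ≤ 4)
    rw [← ENNReal.rpow_mul, ENNReal.mul_rpow_of_nonneg _ _ (by norm_num), ← ENNReal.rpow_mul] at this
    norm_num at this ⊢
    exact this
  have hlim : Filter.Tendsto (fun n : ℕ => ((1 : ℝ) / 2) ^ (n + 1)) Filter.atTop (nhds 0) :=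
    (tendsto_pow_atTop_nhds_zero_of_lt_one (by norm_num) (by norm_num)).comp
      (Filter.tendsto_add_atTop_nat 1)
  have hpt : ∀ x, sphMean (fun y => ENNReal.ofReal (f y)) 1 x ≤ Filter.liminf
      (fun n : ℕ => ‖∫ y, f y * annKer ((1 / 2) ^ (n + 1)) (x - y)‖ₑ) Filter.atTop := by
    intro x
    refine le_of_forall_lt fun c hc => ?_
    obtain ⟨c', hcc', hc'⟩ := exists_between hc
    refine hcc'.trans_le (Filter.le_liminf_of_le (by isBoundedDefault) ?_)
    have hev := (continuous_sphMean hfc hfA x).tendsto 1 |>.eventually (lt_mem_nhds hc')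
    obtain ⟨ε, hε, hball⟩ := Metric.eventually_nhds_iff.1 hev
    filter_upwards [hlim.eventually (gt_mem_nhds hε)] with n hn
    refine le_enorm_integral_mul_annKer hfc.measurable hf0 hf (by positivity) x fun r hr => ?_
    refine (hball ?_).le
    rw [Real.dist_eq, abs_of_nonneg (by linarith [hr.1])]
    linarith [hr.2]
  calc ∫⁻ x, sphMean (fun y => ENNReal.ofReal (f y)) 1 x ^ (4 : ℝ)
      ≤ ∫⁻ x, Filter.liminf
        (fun n : ℕ => ‖∫ y, f y * annKer ((1 / 2) ^ (n + 1)) (x - y)‖ₑ ^ (4 : ℝ)) Filter.atTop := by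
        refine lintegral_mono fun x => ?_
        have := (ENNReal.orderIsoRpow 4 (by norm_num)).liminf_apply (f := Filter.atTop)
          (u := fun n : ℕ => ‖∫ y, f y * annKer ((1 / 2) ^ (n + 1)) (x - y)‖ₑ)
        simp only [ENNReal.orderIsoRpow_apply] at this
        rw [← this]
        exact ENNReal.rpow_le_rpow (hpt x) (by norm_num)
    _ ≤ Filter.liminf (fun n : ℕ =>
        ∫⁻ x, ‖∫ y, f y * annKer ((1 / 2) ^ (n + 1)) (x - y)‖ₑ ^ (4 : ℝ)) Filter.atTop :=
        lintegral_liminf_le fun n =>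
          (measurable_integral_mul_sub hfc.measurable (measurable_annKer _)).enorm.pow_const _
    _ ≤ _ := Filter.liminf_le_of_frequently_le' (Filter.Frequently.of_forall hb')

theorem exists_sphMean_bound : ∃ C : ℝ≥0∞, C ≠ ∞ ∧ ∀ f : E3 → ℝ, Continuous f →
    (∀ x, 0 ≤ f x) → Integrable f → ∀ A : ℝ, (∀ x, f x ≤ A) → ∀ r : ℝ, 0 < r →
    ∫⁻ x, sphMean (fun y => ENNReal.ofReal (f y)) r x ^ (4 : ℝ) ≤
      C * ENNReal.ofReal (r ^ (-(9 / 2) : ℝ)) *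
        (∫⁻ x, ENNReal.ofReal (f x) ^ (8 / 5 : ℝ)) ^ (5 / 2 : ℝ) := by
  obtain ⟨C, hC, hb⟩ := exists_sphMean_one_bound
  refine ⟨C, hC, fun f hfc hf0 hf A hfA r hr => ?_⟩
  have hscale : ∀ (s : ℝ) (F : E3 → ℝ≥0∞), 0 < s → Measurable F →
      ∫⁻ x, F (s • x) = ENNReal.ofReal (s⁻¹ ^ 3) * ∫⁻ x, F x := by
    intro s F hs hF
    have h1 := Measure.map_addHaar_smul (volume : Measure E3) hs.ne'
    rw [← lintegral_map hF (measurable_const_smul s), h1, lintegral_smul_measure, smul_eq_mul]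
    congr 2
    rw [abs_of_pos (by positivity)]
    simp
  have hmean : ∀ x, sphMean (fun y => ENNReal.ofReal (f (r • y))) 1 x =
      sphMean (fun y => ENNReal.ofReal (f y)) r (r • x) := by
    intro x
    simp [sphMean, smul_add]
  have hg := hb (fun x => f (r • x)) (hfc.comp (by fun_prop)) (fun x => hf0 _)
    (hf.comp_smul hr.ne') A (fun x => hfA _)
  simp only [hmean] at hg
  have hm1 : Measurable fun x => sphMean (fun y => ENNReal.ofReal (f y)) r x ^ (4 : ℝ) :=
    ((measurable_sphMean (ENNReal.continuous_ofReal.comp hfc).measurable).comp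
      measurable_prodMk_left).pow_const _
  have hm2 : Measurable fun x => ENNReal.ofReal (f x) ^ (8 / 5 : ℝ) :=
    (ENNReal.continuous_ofReal.comp hfc).measurable.pow_const _
  rw [hscale r _ hr hm1, hscale r _ hr hm2, ENNReal.mul_rpow_of_nonneg _ _ (by norm_num)] at hg
  set N := ∫⁻ x, ENNReal.ofReal (f x) ^ (8 / 5 : ℝ)
  calc _ = ENNReal.ofReal (r ^ 3) * (ENNReal.ofReal (r⁻¹ ^ 3) *
        ∫⁻ x, sphMean (fun y => ENNReal.ofReal (f y)) r x ^ (4 : ℝ)) := by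
        rw [← mul_assoc, ← ENNReal.ofReal_mul (by positivity), ← mul_pow, mul_inv_cancel₀ hr.ne',
          one_pow, ENNReal.ofReal_one, one_mul]
    _ ≤ ENNReal.ofReal (r ^ 3) * (C * (ENNReal.ofReal (r⁻¹ ^ 3) ^ (5 / 2 : ℝ) * N ^ (5 / 2 : ℝ))) := by
        gcongr
    _ = C * (ENNReal.ofReal (r ^ 3) * ENNReal.ofReal (r⁻¹ ^ 3) ^ (5 / 2 : ℝ)) * N ^ (5 / 2 : ℝ) := by
        ring
    _ = _ := by
        congr 2
        rw [ENNReal.ofReal_rpow_of_pos (by positivity), ← ENNReal.ofReal_mul (by positivity)]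
        congr 1
        rw [inv_pow, Real.inv_rpow (by positivity), ← Real.rpow_neg (by positivity),
          ← Real.rpow_natCast, ← Real.rpow_mul hr.le, ← Real.rpow_add hr]
        norm_num

def IsSchwartz.toSchwartzMap {f : E3 → ℝ} (hf : IsSchwartz f) : SchwartzMap E3 ℝ := ⟨f, hf.1, hf.2⟩

theorem IsSchwartz.tendsto_cocompact {f : E3 → ℝ} (hf : IsSchwartz f) :
    Filter.Tendsto f (Filter.cocompact E3) (nhds 0) :=
  zero_at_infty hf.toSchwartzMap

theorem IsSchwartz.exists_bound {f : E3 → ℝ} (hf : IsSchwartz f) :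
    ∃ A : ℝ, ∀ x, |f x| ≤ A := by
  obtain ⟨A, hA⟩ := hf.2 0 0
  exact ⟨A, fun x => by simpa using hA x⟩

theorem IsSchwartz.integrable {f : E3 → ℝ} (hf : IsSchwartz f) : Integrable f :=
  hf.toSchwartzMap.integrable

theorem IsSchwartz.integrable_abs_pow_five {f : E3 → ℝ} (hf : IsSchwartz f) :
    Integrable fun x => |f x| ^ 5 := by
  obtain ⟨A, hA⟩ := hf.exists_bound
  have h1 : Integrable fun x => |f x| ^ 4 * |f x| := by
    refine hf.integrable.abs.bdd_mul (c := A ^ 4)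
      ((hf.1.continuous.abs.pow 4).aestronglyMeasurable) (Filter.Eventually.of_forall fun x => ?_)
    rw [Real.norm_of_nonneg (by positivity)]
    exact pow_le_pow_left₀ (abs_nonneg _) (hA x) 4
  exact h1.congr (Filter.Eventually.of_forall fun x => (pow_succ _ 4).symm)

theorem exists_lintegral_sphMean_pow_five_bound : ∃ C : ℝ≥0∞, C ≠ ∞ ∧ ∀ v : E3 → ℝ, IsSchwartz v →
    ∀ r : ℝ, 0 < r →
    (∫⁻ x, (ENNReal.ofReal r * sphMean (fun y => ‖v y‖ₑ ^ 5) r x) ^ (8 : ℝ)) ^ (1 / 8 : ℝ) ≤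
      C * xNorm 2 (fun x => gradient v x) ^ (1 / 2 : ℝ) *
        (ENNReal.ofReal (r ^ (-(9 / 16) : ℝ)) * xNorm 8 v ^ (9 / 2 : ℝ)) := by
  obtain ⟨C, hC, hb⟩ := exists_sphMean_bound
  refine ⟨(625 * C) ^ (1 / 8 : ℝ), ENNReal.rpow_ne_top_of_nonneg (by norm_num)
    (ENNReal.mul_ne_top (by simp) hC), fun v hv r hr => ?_⟩
  obtain ⟨A, hA⟩ := hv.exists_bound
  have hvc : Continuous v := hv.1.continuous
  have e5 : (fun y => ENNReal.ofReal (|v y| ^ 5)) = fun y => ‖v y‖ₑ ^ 5 := by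
    funext y
    rw [ENNReal.ofReal_pow (abs_nonneg _), Real.enorm_eq_ofReal_abs]
  have h4 := hb (fun x => |v x| ^ 5) (by fun_prop) (fun x => by positivity)
    hv.integrable_abs_pow_five (A ^ 5) (fun x => pow_le_pow_left₀ (abs_nonneg _) (hA x) 5) r hr
  have e8 : ∫⁻ x, ENNReal.ofReal (|v x| ^ 5) ^ (8 / 5 : ℝ) = ∫⁻ x, ‖v x‖ₑ ^ (8 : ℝ) := by
    refine lintegral_congr fun x => ?_
    rw [ENNReal.ofReal_pow (abs_nonneg _), ← Real.enorm_eq_ofReal_abs, ← ENNReal.rpow_natCast,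
      ← ENNReal.rpow_mul]
    norm_num
  have hsup := fun x => sphMean_pow_five_le (hv.1.of_le (by norm_num)) hv.tendsto_cocompact hr x
  rw [e5, e8] at h4
  set P : ℝ≥0∞ := ∫⁻ x, ‖v x‖ₑ ^ (8 : ℝ) with hP
  set Q : ℝ≥0∞ := ∫⁻ x, ‖gradient v x‖ₑ ^ (2 : ℝ) with hQ
  have hM : xNorm 8 v = P ^ (1 / 8 : ℝ) := rfl
  have hE : xNorm 2 (fun x => gradient v x) = Q ^ (1 / 2 : ℝ) := rfl
  rw [hM, hE]
  set S : E3 → ℝ≥0∞ := sphMean (fun y => ‖v y‖ₑ ^ 5) r with hS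
  set c : ℝ≥0∞ := ENNReal.ofReal r⁻¹ with hc
  have hcr : c * ENNReal.ofReal r = 1 := by
    rw [hc, ← ENNReal.ofReal_mul (by positivity), inv_mul_cancel₀ hr.ne', ENNReal.ofReal_one]
  have hsup' : ∀ x, ENNReal.ofReal r * S x ≤ c * (5 * (P ^ (1 / 2 : ℝ) * Q ^ (1 / 2 : ℝ))) := by
    intro x
    calc ENNReal.ofReal r * S x = c * ENNReal.ofReal r * (ENNReal.ofReal r * S x) := by
          rw [hcr, one_mul]
      _ = c * (ENNReal.ofReal (r ^ 2) * S x) := by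
          rw [ENNReal.ofReal_pow hr.le]; ring
      _ ≤ _ := mul_le_mul_right (hsup x) c
  have hSm : Measurable fun x => (ENNReal.ofReal r * S x) ^ (4 : ℝ) := by
    have : Measurable S := (measurable_sphMean (hvc.enorm.measurable.pow_const 5)).comp
      measurable_prodMk_left
    exact (this.const_mul _).pow_const _
  have hmain : ∫⁻ x, (ENNReal.ofReal r * S x) ^ (8 : ℝ) ≤
      625 * C * (Q ^ (2 : ℝ) * (ENNReal.ofReal (r ^ (-(9 / 2) : ℝ)) * P ^ (9 / 2 : ℝ))) := by
    calc ∫⁻ x, (ENNReal.ofReal r * S x) ^ (8 : ℝ)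
        = ∫⁻ x, (ENNReal.ofReal r * S x) ^ (4 : ℝ) * (ENNReal.ofReal r * S x) ^ (4 : ℝ) := by
          refine lintegral_congr fun x => ?_
          rw [← ENNReal.rpow_add_of_nonneg _ _ (by norm_num) (by norm_num)]
          norm_num
      _ ≤ ∫⁻ x, (c * (5 * (P ^ (1 / 2 : ℝ) * Q ^ (1 / 2 : ℝ)))) ^ (4 : ℝ) *
            (ENNReal.ofReal r * S x) ^ (4 : ℝ) := by
          refine lintegral_mono fun x => mul_le_mul_left (ENNReal.rpow_le_rpow (hsup' x) ?_) _
          norm_num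
      _ = (c * (5 * (P ^ (1 / 2 : ℝ) * Q ^ (1 / 2 : ℝ)))) ^ (4 : ℝ) *
            (ENNReal.ofReal r ^ (4 : ℝ) * ∫⁻ x, S x ^ (4 : ℝ)) := by
          rw [lintegral_const_mul _ hSm]
          congr 1
          rw [← lintegral_const_mul' _ _
            (ENNReal.rpow_ne_top_of_nonneg (by norm_num) ENNReal.ofReal_ne_top)]
          exact lintegral_congr fun x => ENNReal.mul_rpow_of_nonneg _ _ (by norm_num)
      _ ≤ (c * (5 * (P ^ (1 / 2 : ℝ) * Q ^ (1 / 2 : ℝ)))) ^ (4 : ℝ) *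
            (ENNReal.ofReal r ^ (4 : ℝ) *
              (C * ENNReal.ofReal (r ^ (-(9 / 2) : ℝ)) * P ^ (5 / 2 : ℝ))) := by
          gcongr
      _ = (c * ENNReal.ofReal r) ^ (4 : ℝ) * (5 ^ (4 : ℝ) * C * (Q ^ (2 : ℝ) *
            (ENNReal.ofReal (r ^ (-(9 / 2) : ℝ)) * (P ^ (2 : ℝ) * P ^ (5 / 2 : ℝ))))) := by
          simp only [ENNReal.mul_rpow_of_nonneg _ _ (by norm_num : (0 : ℝ) ≤ 4), ← ENNReal.rpow_mul]
          norm_num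
          ring
      _ = _ := by
          rw [hcr, ← ENNReal.rpow_add_of_nonneg _ _ (by norm_num) (by norm_num)]
          norm_num
  calc _ ≤ (625 * C * (Q ^ (2 : ℝ) *
        (ENNReal.ofReal (r ^ (-(9 / 2) : ℝ)) * P ^ (9 / 2 : ℝ)))) ^ (1 / 8 : ℝ) := by gcongr
    _ = _ := by
      have hr' : ENNReal.ofReal (r ^ (-(9 / 2) : ℝ)) ^ (1 / 8 : ℝ) =
          ENNReal.ofReal (r ^ (-(9 / 16) : ℝ)) := by
        rw [ENNReal.ofReal_rpow_of_pos (by positivity), ← Real.rpow_mul hr.le]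
        norm_num
      rw [ENNReal.mul_rpow_of_nonneg _ _ (by norm_num), ENNReal.mul_rpow_of_nonneg _ _ (by norm_num),
        ENNReal.mul_rpow_of_nonneg _ _ (by norm_num), ENNReal.mul_rpow_of_nonneg _ _ (by norm_num), hr', ← ENNReal.rpow_mul, ← ENNReal.rpow_mul,
        ← ENNReal.rpow_mul, ← ENNReal.rpow_mul]
      norm_num
      ring

/-- Minkowski's integral inequality. -/
theorem lintegral_rpow_lintegral_le {α β : Type*} [MeasurableSpace α] [MeasurableSpace β]
    {μ : Measure α} [SFinite μ] {ν : Measure β} [SigmaFinite ν] {g : α × β → ℝ≥0∞}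
    (hg : Measurable g) {p : ℝ} (hp : 1 < p) :
    (∫⁻ x, (∫⁻ s, g (s, x) ∂μ) ^ p ∂ν) ^ (1 / p) ≤ ∫⁻ s, (∫⁻ x, g (s, x) ^ p ∂ν) ^ (1 / p) ∂μ := by
  have hp0 : 0 < p := by linarith
  set G : β → ℝ≥0∞ := fun x => ∫⁻ s, g (s, x) ∂μ with hG
  set R : ℝ≥0∞ := ∫⁻ s, (∫⁻ x, g (s, x) ^ p ∂ν) ^ (1 / p) ∂μ with hR
  have hGm : Measurable G := hg.lintegral_prod_left'
  set H : ℕ → β → ℝ≥0∞ := fun k => (spanningSets ν k).indicator fun x => min (G x) k with hH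
  have hHm : ∀ k, Measurable (H k) := fun k =>
    (hGm.min measurable_const).indicator (measurableSet_spanningSets ν k)
  have hHG : ∀ k x, H k x ≤ G x := fun k x =>
    (Set.indicator_le_self _ _ _).trans (min_le_left _ _)
  have hfin : ∀ k, ∫⁻ x, H k x ^ p ∂ν ≠ ∞ := by
    intro k
    refine ne_top_of_le_ne_top (b := (k : ℝ≥0∞) ^ p * ν (spanningSets ν k)) ?_ ?_
    · exact ENNReal.mul_ne_top (ENNReal.rpow_ne_top_of_nonneg hp0.le (ENNReal.natCast_ne_top k))
        (measure_spanningSets_lt_top ν k).ne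
    · rw [← lintegral_indicator_const (measurableSet_spanningSets ν k)]
      refine lintegral_mono fun x => ?_
      by_cases hx : x ∈ spanningSets ν k
      · simp only [hH, Set.indicator_of_mem hx]
        exact ENNReal.rpow_le_rpow (min_le_right _ _) hp0.le
      · simp [hH, Set.indicator_of_notMem hx, hp0]
  have hpq : p.HolderConjugate (p / (p - 1)) := Real.HolderConjugate.conjExponent hp
  have hq : (p - 1) * (p / (p - 1)) = p := by
    have : p - 1 ≠ 0 := by linarith
    field_simp
  have hq' : 1 / (p / (p - 1)) = 1 - 1 / p := by
    have : p - 1 ≠ 0 := by linarith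
    field_simp
  have hbound : ∀ k, ∫⁻ x, H k x ^ p ∂ν ≤ R ^ p := by
    intro k
    set J : ℝ≥0∞ := ∫⁻ x, H k x ^ p ∂ν with hJ
    have h1 : J ≤ R * J ^ (1 - 1 / p) := by
      calc J = ∫⁻ x, H k x * H k x ^ (p - 1) ∂ν := by
            refine lintegral_congr fun x => ?_
            have := ENNReal.rpow_add_of_nonneg (x := H k x) 1 (p - 1) zero_le_one (by linarith)
            rwa [ENNReal.rpow_one, add_sub_cancel] at this
        _ ≤ ∫⁻ x, G x * H k x ^ (p - 1) ∂ν :=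
            lintegral_mono fun x => mul_le_mul_left (hHG k x) _
        _ = ∫⁻ x, ∫⁻ s, g (s, x) * H k x ^ (p - 1) ∂μ ∂ν := by
            refine lintegral_congr fun x => ?_
            have : Measurable fun s => g (s, x) := hg.comp measurable_prodMk_right
            rw [lintegral_mul_const _ this]
        _ = ∫⁻ s, ∫⁻ x, g (s, x) * H k x ^ (p - 1) ∂ν ∂μ := by
            refine (lintegral_lintegral_swap ?_).symm
            exact (hg.mul (((hHm k).comp measurable_snd).pow_const _)).aemeasurable
        _ ≤ ∫⁻ s, (∫⁻ x, g (s, x) ^ p ∂ν) ^ (1 / p) * J ^ (1 - 1 / p) ∂μ := by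
            refine lintegral_mono fun s => ?_
            refine (ENNReal.lintegral_mul_le_Lp_mul_Lq ν hpq
              (hg.comp measurable_prodMk_left).aemeasurable
              ((hHm k).pow_const (p - 1)).aemeasurable).trans (le_of_eq ?_)
            simp only [← ENNReal.rpow_mul, hq, hq', hJ, Function.comp_def]
        _ = R * J ^ (1 - 1 / p) := by
            have : Measurable fun q : α × β => g q ^ p := hg.pow_const p
            rw [lintegral_mul_const _ (this.lintegral_prod_right'.pow_const _)]
    by_cases hJ0 : J = 0
    · rw [hJ0]; exact zero_le
    have hJt : J ≠ ∞ := hfin k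
    have h2 : J = J ^ (1 / p) * J ^ (1 - 1 / p) := by
      rw [← ENNReal.rpow_add _ _ hJ0 hJt, add_sub_cancel, ENNReal.rpow_one]
    have h3 : J ^ (1 / p) ≤ R := by
      have h4 : J ^ (1 / p) * J ^ (1 - 1 / p) ≤ R * J ^ (1 - 1 / p) := h2 ▸ h1
      have hne : J ^ (1 - 1 / p) ≠ 0 := by
        simp [ENNReal.rpow_eq_zero_iff, hJ0, hJt]
      have hnt : J ^ (1 - 1 / p) ≠ ∞ := by
        simp [ENNReal.rpow_eq_top_iff, hJ0, hJt]
      exact (ENNReal.mul_le_mul_iff_left hne hnt).1 h4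
    calc J = (J ^ (1 / p)) ^ p := by
          rw [← ENNReal.rpow_mul, one_div, inv_mul_cancel₀ hp0.ne', ENNReal.rpow_one]
      _ ≤ R ^ p := ENNReal.rpow_le_rpow h3 hp0.le
  have hlim : ∀ x, Filter.Tendsto (fun k => H k x ^ p) Filter.atTop (nhds (G x ^ p)) := by
    intro x
    refine (ENNReal.continuous_rpow_const.tendsto _).comp ?_
    have h1 : Filter.Tendsto (fun k : ℕ => min (G x) (k : ℝ≥0∞)) Filter.atTop (nhds (min (G x) ∞)) :=
      tendsto_const_nhds.min ENNReal.tendsto_nat_nhds_top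
    rw [min_eq_left le_top] at h1
    refine h1.congr' ?_
    filter_upwards [Filter.eventually_ge_atTop (spanningSetsIndex ν x)] with k hk
    exact (Set.indicator_of_mem (mem_spanningSets_of_index_le ν x hk)
      fun x => min (G x) (k : ℝ≥0∞)).symm
  have hfinal : ∫⁻ x, G x ^ p ∂ν ≤ R ^ p := by
    calc ∫⁻ x, G x ^ p ∂ν = ∫⁻ x, Filter.liminf (fun k => H k x ^ p) Filter.atTop ∂ν :=
          lintegral_congr fun x => (hlim x).liminf_eq.symm
      _ ≤ Filter.liminf (fun k => ∫⁻ x, H k x ^ p ∂ν) Filter.atTop :=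
          lintegral_liminf_le fun k => (hHm k).pow_const p
      _ ≤ R ^ p := Filter.liminf_le_of_frequently_le' (Filter.Frequently.of_forall hbound)
  calc _ ≤ (R ^ p) ^ (1 / p) := ENNReal.rpow_le_rpow hfinal (by positivity)
    _ = R := by rw [← ENNReal.rpow_mul, mul_one_div, div_self hp0.ne', ENNReal.rpow_one]

/-- The absolute value of `u`, extended by zero outside the time set `I`. -/
def absOn (I : Set ℝ) (u : ℝ → E3 → ℝ) : ℝ × E3 → ℝ≥0∞ :=
  (I ×ˢ univ).indicator fun q => ‖u q.1 q.2‖ₑ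

theorem absOn_of_mem {I : Set ℝ} {τ : ℝ} (hτ : τ ∈ I) (u : ℝ → E3 → ℝ) (y : E3) :
    absOn I u (τ, y) = ‖u τ y‖ₑ :=
  Set.indicator_of_mem (s := I ×ˢ univ) ⟨hτ, mem_univ y⟩ _

theorem absOn_of_notMem {I : Set ℝ} {τ : ℝ} (hτ : τ ∉ I) (u : ℝ → E3 → ℝ) (y : E3) :
    absOn I u (τ, y) = 0 :=
  Set.indicator_of_notMem (s := I ×ˢ univ) (fun h => hτ h.1) _

theorem measurable_absOn {I : Set ℝ} (hI : MeasurableSet I) {u : ℝ → E3 → ℝ}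
    (hu : ContinuousOn (uncurry u) (I ×ˢ univ)) : Measurable (absOn I u) := by
  classical
  have h1 : ContinuousOn (fun q : ℝ × E3 => ‖u q.1 q.2‖ₑ) (I ×ˢ univ) :=
    continuous_enorm.comp_continuousOn hu
  rw [absOn, ← Set.piecewise_eq_indicator]
  exact h1.measurable_piecewise continuousOn_const (hI.prod MeasurableSet.univ)

/-- The integrand of the Duhamel integral at time `t`, up to a constant. -/
def duhamelDensity (U : ℝ × E3 → ℝ≥0∞) (t : ℝ) (q : ℝ × E3) : ℝ≥0∞ :=
  ENNReal.ofReal (t - q.1) * sphMean (fun y => U (q.1, y) ^ 5) (t - q.1) q.2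

theorem measurable_duhamelDensity {U : ℝ × E3 → ℝ≥0∞} (hU : Measurable U) (t : ℝ) :
    Measurable (duhamelDensity U t) := by
  have h1 : Measurable fun p : (ℝ × E3) × Metric.sphere (0 : E3) 1 =>
      U (p.1.1, p.1.2 + (t - p.1.1) • (p.2 : E3)) ^ 5 := (hU.comp (by fun_prop)).pow_const 5
  have h2 : Measurable fun q : ℝ × E3 => ENNReal.ofReal (t - q.1) :=
    ENNReal.measurable_ofReal.comp (by fun_prop)
  exact h2.mul h1.lintegral_prod_right'

theorem exists_enorm_duh_le : ∃ K : ℝ≥0∞, K ≠ ∞ ∧ ∀ (t₀ t₁ : ℝ) (u : ℝ → E3 → ℝ),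
    (∀ t ∈ Icc t₀ t₁, Continuous (u t)) → ∀ t ∈ Icc t₀ t₁, ∀ x,
      ‖duh u t₀ t t x‖ₑ ≤ K * ∫⁻ τ, duhamelDensity (absOn (Icc t₀ t₁) u) t (τ, x) := by
  obtain ⟨K, hK, hb⟩ := exists_lintegral_sphere_hausdorff_le
  refine ⟨K, hK, fun t₀ t₁ u hu t ht x => ?_⟩
  rw [duh, intervalIntegral.integral_of_le ht.1, Measure.restrict_congr_set Ioo_ae_eq_Ioc.symm]
  refine (enorm_integral_le_lintegral_enorm _).trans ?_
  rw [← lintegral_const_mul' _ _ hK]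
  refine le_trans (setLIntegral_mono' measurableSet_Ioo fun τ hτ => ?_) (setLIntegral_le_lintegral _ _)
  have hr : 0 < t - τ := by linarith [hτ.2]
  have hτI : τ ∈ Icc t₀ t₁ := ⟨hτ.1.le, hτ.2.le.trans ht.2⟩
  have h1 : ‖sphInt x (t - τ) fun y => u τ y ^ 5‖ₑ ≤ K * ENNReal.ofReal ((t - τ) ^ 2) *
      sphMean (fun y => absOn (Icc t₀ t₁) u (τ, y) ^ 5) (t - τ) x := by
    refine (enorm_integral_le_lintegral_enorm _).trans ?_
    refine (hb x (t - τ) hr (fun y => ‖u τ y ^ 5‖ₑ)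
      ((hu τ hτI).pow 5).enorm.measurable).trans (le_of_eq ?_)
    simp only [sphMean, absOn_of_mem hτI, enorm_pow]
  have h2 : ‖1 / (4 * π * (t - τ))‖ₑ * ENNReal.ofReal ((t - τ) ^ 2) ≤ ENNReal.ofReal (t - τ) := by
    rw [Real.enorm_eq_ofReal (by positivity), ← ENNReal.ofReal_mul (by positivity)]
    refine ENNReal.ofReal_le_ofReal ?_
    rw [one_div_mul_eq_div, div_le_iff₀ (by positivity)]
    nlinarith [Real.pi_gt_three, mul_pos hr hr]
  rw [enorm_mul]
  calc _ ≤ ‖1 / (4 * π * (t - τ))‖ₑ * (K * ENNReal.ofReal ((t - τ) ^ 2) *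
        sphMean (fun y => absOn (Icc t₀ t₁) u (τ, y) ^ 5) (t - τ) x) := mul_le_mul_right h1 _
    _ = K * ((‖1 / (4 * π * (t - τ))‖ₑ * ENNReal.ofReal ((t - τ) ^ 2)) *
        sphMean (fun y => absOn (Icc t₀ t₁) u (τ, y) ^ 5) (t - τ) x) := by ring
    _ ≤ _ := mul_le_mul_right (mul_le_mul_left h2 _) _

theorem exists_duhamelDensity_bound : ∃ C : ℝ≥0∞, C ≠ ∞ ∧ ∀ (t₀ t₁ : ℝ) (u : ℝ → E3 → ℝ),
    (∀ t ∈ Icc t₀ t₁, IsSchwartz (u t)) → ∀ t τ : ℝ,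
      (∫⁻ x, duhamelDensity (absOn (Icc t₀ t₁) u) t (τ, x) ^ (8 : ℝ)) ^ (1 / 8 : ℝ) ≤
        C * (⨆ t ∈ Icc t₀ t₁, xNorm 2 (fun x => gradient (u t) x)) ^ (1 / 2 : ℝ) *
          (rieszKernel (Ioi 0) (t - τ) *
            (∫⁻ x, absOn (Icc t₀ t₁) u (τ, x) ^ (8 : ℝ)) ^ (9 / 16 : ℝ)) := by
  obtain ⟨C, hC, hb⟩ := exists_lintegral_sphMean_pow_five_bound
  refine ⟨C, hC, fun t₀ t₁ u hu t τ => ?_⟩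
  have hzero : (∀ x, duhamelDensity (absOn (Icc t₀ t₁) u) t (τ, x) = 0) →
      (∫⁻ x, duhamelDensity (absOn (Icc t₀ t₁) u) t (τ, x) ^ (8 : ℝ)) ^ (1 / 8 : ℝ) = 0 := by
    intro h
    simp [h]
  by_cases hτ : τ ∈ Icc t₀ t₁
  · by_cases hr : 0 < t - τ
    · have h1 := hb (u τ) (hu τ hτ) (t - τ) hr
      simp only [duhamelDensity, absOn_of_mem hτ]
      rw [rieszKernel, Set.indicator_of_mem (mem_Ioi.2 hr)]
      refine h1.trans ?_
      have h2 : xNorm 8 (u τ) ^ (9 / 2 : ℝ) = (∫⁻ x, ‖u τ x‖ₑ ^ (8 : ℝ)) ^ (9 / 16 : ℝ) := by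
        simp only [xNorm]
        rw [← ENNReal.rpow_mul]
        norm_num
        rfl
      rw [h2]
      gcongr
      exact le_iSup₂_of_le τ hτ le_rfl
    · rw [hzero fun x => ?_]
      · exact zero_le
      · simp [duhamelDensity, ENNReal.ofReal_of_nonpos (not_lt.1 hr)]
  · rw [hzero fun x => ?_]
    · exact zero_le
    · simp [duhamelDensity, sphMean, absOn_of_notMem hτ]

/-- nonlinear estimate for the variable-endpoint Duhamel integral:
`‖∫_{t₀}^t S(t-τ)(0,u⁵) dτ‖_{L⁸} ≲ (sup_t ‖∇u(t)‖_{L²})^{1/2} ‖u‖_{L⁸}^{9/2}`. -/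
theorem stmt5 :
    ∃ C : ℝ, 0 < C ∧ ∀ (t₀ t₁ : ℝ), t₀ ≤ t₁ → ∀ u : ℝ → E3 → ℝ,
      ContDiffOn ℝ (⊤ : ℕ∞) (uncurry u) (Icc t₀ t₁ ×ˢ univ) →
      (∀ t ∈ Icc t₀ t₁, IsSchwartz (u t)) →
      mixNorm 8 8 (Icc t₀ t₁) (fun t x => duh u t₀ t t x) ≤
        ENNReal.ofReal C * (⨆ t ∈ Icc t₀ t₁, xNorm 2 (fun x => gradient (u t) x)) ^ ((1:ℝ)/2)
          * (mixNorm 8 8 (Icc t₀ t₁) u) ^ ((9:ℝ)/2) := by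
  obtain ⟨K, hK, hduh⟩ := exists_enorm_duh_le
  obtain ⟨C, hC, hdens⟩ := exists_duhamelDensity_bound
  obtain ⟨D, hD, hriesz⟩ := exists_rieszPotential_bound
  set B : ℝ≥0∞ := K * C * D ^ (1 / 8 : ℝ) with hB
  have hBtop : B ≠ ∞ := ENNReal.mul_ne_top (ENNReal.mul_ne_top hK hC)
    (ENNReal.rpow_ne_top_of_nonneg (by norm_num) hD)
  refine ⟨B.toReal + 1, by positivity, fun t₀ t₁ _ u hu hS => ?_⟩
  set E : ℝ≥0∞ := ⨆ t ∈ Icc t₀ t₁, xNorm 2 (fun x => gradient (u t) x) with hE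
  set U : ℝ × E3 → ℝ≥0∞ := absOn (Icc t₀ t₁) u with hU
  have hUm : Measurable U := measurable_absOn measurableSet_Icc hu.continuousOn
  set h : ℝ → ℝ≥0∞ := fun τ => (∫⁻ x, U (τ, x) ^ (8 : ℝ)) ^ (9 / 16 : ℝ) with hh
  have hhm : Measurable h := by
    have : Measurable fun q => U q ^ (8 : ℝ) := hUm.pow_const _
    exact this.lintegral_prod_right'.pow_const _
  set Φ : ℝ → ℝ≥0∞ := fun t => ∫⁻ τ, rieszKernel (Ioi 0) (t - τ) * h τ with hΦ
  have hkm := measurable_rieszKernel_sub_mul (measurableSet_Ioi (a := (0 : ℝ))) hhm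
  have hΦm : Measurable Φ := hkm.lintegral_prod_right'
  have hfix : ∀ t ∈ Icc t₀ t₁, xNorm 8 (fun x => duh u t₀ t t x) ≤
      K * (C * E ^ (1 / 2 : ℝ)) * Φ t := by
    intro t ht
    have hdm := measurable_duhamelDensity hUm t
    have hcur : Measurable fun τ => rieszKernel (Ioi 0) (t - τ) * h τ := hkm.comp measurable_prodMk_left
    have hin : Measurable fun x => (∫⁻ τ, duhamelDensity U t (τ, x)) ^ (8 : ℝ) :=
      hdm.lintegral_prod_left'.pow_const _
    calc xNorm 8 (fun x => duh u t₀ t t x)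
        ≤ (∫⁻ x, (K * ∫⁻ τ, duhamelDensity U t (τ, x)) ^ (8 : ℝ)) ^ (1 / 8 : ℝ) := by
          refine ENNReal.rpow_le_rpow (lintegral_mono fun x => ENNReal.rpow_le_rpow ?_ ?_) ?_
          · exact hduh t₀ t₁ u (fun s hs => (hS s hs).1.continuous) t ht x
          · norm_num
          · norm_num
      _ = K * (∫⁻ x, (∫⁻ τ, duhamelDensity U t (τ, x)) ^ (8 : ℝ)) ^ (1 / 8 : ℝ) := by
          simp only [ENNReal.mul_rpow_of_nonneg _ _ (by norm_num : (0 : ℝ) ≤ 8)]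
          rw [lintegral_const_mul _ hin, ENNReal.mul_rpow_of_nonneg _ _ (by norm_num),
            ← ENNReal.rpow_mul]
          norm_num
      _ ≤ K * ∫⁻ τ, (∫⁻ x, duhamelDensity U t (τ, x) ^ (8 : ℝ)) ^ (1 / 8 : ℝ) :=
          mul_le_mul_right (lintegral_rpow_lintegral_le hdm (by norm_num)) _
      _ ≤ K * ∫⁻ τ, C * E ^ (1 / 2 : ℝ) * (rieszKernel (Ioi 0) (t - τ) * h τ) :=
          mul_le_mul_right (lintegral_mono fun τ => hdens t₀ t₁ u hS t τ) _
      _ = _ := by rw [lintegral_const_mul _ hcur, mul_assoc K]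
  have hZ : ∫⁻ τ, h τ ^ (16 / 9 : ℝ) = ∫⁻ t in Icc t₀ t₁, xNorm 8 (u t) ^ (8 : ℝ) := by
    rw [← lintegral_indicator measurableSet_Icc]
    refine lintegral_congr fun τ => ?_
    simp only [hh]
    rw [← ENNReal.rpow_mul]
    norm_num
    by_cases hτ : τ ∈ Icc t₀ t₁
    · simp only [Set.indicator_of_mem hτ, hU, absOn_of_mem hτ, xNorm]
      rw [← ENNReal.rpow_natCast _ 8, ← ENNReal.rpow_mul]
      norm_num
      rfl
    · simp [Set.indicator_of_notMem hτ, hU, absOn_of_notMem hτ]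
  calc mixNorm 8 8 (Icc t₀ t₁) (fun t x => duh u t₀ t t x)
      ≤ (∫⁻ t, (K * (C * E ^ (1 / 2 : ℝ)) * Φ t) ^ (8 : ℝ)) ^ (1 / 8 : ℝ) := by
        refine ENNReal.rpow_le_rpow ((setLIntegral_mono' measurableSet_Icc fun t ht =>
          ENNReal.rpow_le_rpow (hfix t ht) ?_).trans (setLIntegral_le_lintegral _ _)) ?_
        · norm_num
        · norm_num
    _ = K * (C * E ^ (1 / 2 : ℝ)) * (∫⁻ t, Φ t ^ (8 : ℝ)) ^ (1 / 8 : ℝ) := by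
        simp only [ENNReal.mul_rpow_of_nonneg _ (Φ _) (by norm_num : (0 : ℝ) ≤ 8)]
        rw [lintegral_const_mul _ (hΦm.pow_const _), ENNReal.mul_rpow_of_nonneg _ _ (by norm_num),
          ← ENNReal.rpow_mul]
        norm_num
    _ ≤ K * (C * E ^ (1 / 2 : ℝ)) *
          (D * (∫⁻ τ, h τ ^ (16 / 9 : ℝ)) ^ (9 / 2 : ℝ)) ^ (1 / 8 : ℝ) :=
        mul_le_mul_right (ENNReal.rpow_le_rpow (hriesz h hhm) (by norm_num)) _
    _ = B * E ^ (1 / 2 : ℝ) * mixNorm 8 8 (Icc t₀ t₁) u ^ (9 / 2 : ℝ) := by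
        rw [hZ, mixNorm, ENNReal.mul_rpow_of_nonneg _ _ (by norm_num), ← ENNReal.rpow_mul,
          ← ENNReal.rpow_mul, hB, mul_comm (9 / 2 : ℝ) (1 / 8)]
        ring
    _ ≤ _ := by
        gcongr
        rw [ENNReal.le_ofReal_iff_toReal_le hBtop (by positivity)]
        linarith

end
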